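/- The set 𝔾 = {(d₂₂*)^α·d₂₂^β·m : 0 ≤ α, β ≤ q−2, m ∈ 𝕊} is a set of q(q²−1)(q−1)² elements which forms a basis of R₂^{SL₂} as a free module over the subalgebra ℬ. -/

import Mathlib

open MvPolynomial

noncomputable section

abbrev R2 (F : Type) [Field F] : Type := MvPolynomial (Fin 4) F

/-- The action of `A ∈ GL₂(F)` on `R₂ = F[x₁,x₂,y₁,y₂]` (variables `X 0, X 1, X 2, X 3`). -/
def act {F : Type} [Field F] (A : GL (Fin 2) F) : R2 F →ₐ[F] R2 F :=
  aeval ![C ((A.val.det)⁻¹ * A.val 1 1) * X 0 - C ((A.val.det)⁻¹ * A.val 1 0) * X 1,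
          C ((A.val.det)⁻¹ * A.val 0 0) * X 1 - C ((A.val.det)⁻¹ * A.val 0 1) * X 0,
          C (A.val 0 0) * X 2 + C (A.val 0 1) * X 3,
          C (A.val 1 0) * X 2 + C (A.val 1 1) * X 3]

/-- The invariant ring `R₂^G` for a subgroup `G ≤ GL₂(F)`. -/
def invariantRing {F : Type} [Field F] (G : Subgroup (GL (Fin 2) F)) : Subalgebra F (R2 F) where
  carrier := {f | ∀ A ∈ G, act A f = f}
  mul_mem' := fun hf hg A hA => by rw [map_mul, hf A hA, hg A hA]
  add_mem' := fun hf hg A hA => by rw [map_add, hf A hA, hg A hA]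
  one_mem' := fun A _ => map_one (act A)
  zero_mem' := fun A _ => map_zero (act A)
  algebraMap_mem' := fun r A _ => (act A).commutes r

/-- `SL₂(F)` as a subgroup of `GL₂(F)`. -/
def SL2 (F : Type) [Field F] : Subgroup (GL (Fin 2) F) where
  carrier := {A | A.val.det = 1}
  one_mem' := by simp
  mul_mem' := by
    intro a b ha hb
    simp only [Set.mem_setOf_eq, Units.val_mul, Matrix.det_mul] at *
    rw [ha, hb, mul_one]
  inv_mem' := by
    intro a ha
    have h : ((a⁻¹).val * a.val).det = 1 := by
      rw [← Units.val_mul, inv_mul_cancel, Units.val_one, Matrix.det_one]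
    simp only [Matrix.det_mul] at h
    rw [Set.mem_setOf_eq] at ha ⊢
    rw [ha, mul_one] at h
    exact h

/-- `P₂(F)`: upper triangular matrices in `SL₂(F)` with 1's on the diagonal. -/
def P2 (F : Type) [Field F] : Subgroup (GL (Fin 2) F) where
  carrier := {A | A.val 0 0 = 1 ∧ A.val 1 1 = 1 ∧ A.val 1 0 = 0}
  one_mem' := by simp
  mul_mem' := by
    intro a b ha hb
    obtain ⟨ha1, ha2, ha3⟩ := ha
    obtain ⟨hb1, hb2, hb3⟩ := hb
    refine ⟨?_, ?_, ?_⟩ <;>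
      simp [Units.val_mul, Matrix.mul_apply, Fin.sum_univ_two, ha1, ha2, ha3, hb1, hb2, hb3]
  inv_mem' := by
    intro a ha
    obtain ⟨ha1, ha2, ha3⟩ := ha
    have hdet : a.val.det = 1 := by
      rw [Matrix.det_fin_two, ha1, ha2, ha3]; ring
    have hinv : (a⁻¹).val = a.val⁻¹ := by
      simp [Matrix.coe_units_inv]
    refine ⟨?_, ?_, ?_⟩ <;>
      simp [hinv, Matrix.inv_def, hdet, Matrix.adjugate_fin_two, ha1, ha2, ha3]

def d22 (F : Type) [Field F] (q : ℕ) : R2 F := X 1 * X 0 ^ q - X 0 * X 1 ^ q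
def d22s (F : Type) [Field F] (q : ℕ) : R2 F := X 2 * X 3 ^ q - X 3 * X 2 ^ q
def u0 (F : Type) [Field F] : R2 F := X 0 * X 2 + X 1 * X 3
def u1 (F : Type) [Field F] (q : ℕ) : R2 F := X 0 ^ q * X 2 + X 1 ^ q * X 3
def u1s (F : Type) [Field F] (q : ℕ) : R2 F := X 0 * X 2 ^ q + X 1 * X 3 ^ q
def phi1 (F : Type) [Field F] : R2 F := X 0
def phi2 (F : Type) [Field F] (q : ℕ) : R2 F := X 1 ^ q - X 1 * X 0 ^ (q - 1)
def phi1s (F : Type) [Field F] : R2 F := X 3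
def phi2s (F : Type) [Field F] (q : ℕ) : R2 F := X 2 ^ q - X 2 * X 3 ^ (q - 1)

/-- Closure of the module spanned by the generators under multiplication by `u` and `v`. -/
theorem mul_mem_of_relations {R : Type*} [CommRing R] {q : ℕ} (hq : 2 ≤ q)
    {δ δs c cs u v w : R} {h : ℕ → R}
    (hvw : v * w = u ^ (q + 1) + δ * δs) (h0 : h 0 = cs) (hq1 : h (q - 1) = c)
    (hu : ∀ s ≤ q - 1, u ^ q * h s = v ^ (s + 1) * δs ^ (q - s - 1) + w ^ (q - s) * δ ^ s)
    (hv : ∀ s, s + 1 ≤ q - 1 → h s * v = δs * h (s + 1) + w ^ (q - s - 1) * δ ^ s * u)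
    (hw : ∀ s, s + 1 ≤ q - 1 → h (s + 1) * w = δ * h s + v ^ (s + 1) * δs ^ (q - s - 2) * u)
    (M : AddSubgroup R) (mδ : ∀ m ∈ M, δ * m ∈ M) (mδs : ∀ m ∈ M, δs * m ∈ M)
    (mc : ∀ m ∈ M, c * m ∈ M) (mcs : ∀ m ∈ M, cs * m ∈ M)
    (hI : ∀ i j, i ≤ q - 1 → j ≤ q - 1 → w ^ i * v ^ j ∈ M)
    (hII : ∀ i j k, i ≤ q - 2 → j ≤ q - 2 → 1 ≤ k → k ≤ q → w ^ i * v ^ j * u ^ k ∈ M)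
    (hIII : ∀ s k, 1 ≤ s → s ≤ q - 2 → k ≤ q - 1 → h s * u ^ k ∈ M)
    (hspan : ∀ x, (∀ i j, i ≤ q - 1 → j ≤ q - 1 → x * (w ^ i * v ^ j) ∈ M) →
      (∀ i j k, i ≤ q - 2 → j ≤ q - 2 → 1 ≤ k → k ≤ q → x * (w ^ i * v ^ j * u ^ k) ∈ M) →
      (∀ s k, 1 ≤ s → s ≤ q - 2 → k ≤ q - 1 → x * (h s * u ^ k) ∈ M) → ∀ m ∈ M, x * m ∈ M) :
    (∀ m ∈ M, u * m ∈ M) ∧ (∀ m ∈ M, v * m ∈ M) := by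
  have pδ : ∀ n, ∀ m ∈ M, δ ^ n * m ∈ M := by
    intro n; induction n with
    | zero => simp
    | succ n ih => intro m hm; rw [pow_succ, mul_assoc]; exact ih _ (mδ m hm)
  have pδs : ∀ n, ∀ m ∈ M, δs ^ n * m ∈ M := by
    intro n; induction n with
    | zero => simp
    | succ n ih => intro m hm; rw [pow_succ, mul_assoc]; exact ih _ (mδs m hm)
  have hone : (1 : R) ∈ M := by simpa using hI 0 0 (by omega) (by omega)
  have hup : ∀ k ≤ q, u ^ k ∈ M := by
    intro k hk
    rcases Nat.eq_zero_or_pos k with rfl | hk0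
    · simpa using hone
    · simpa using hII 0 0 k (by omega) (by omega) hk0 hk
  have hvp : ∀ j ≤ q - 1, v ^ j ∈ M := fun j hj => by simpa using hI 0 j (by omega) hj
  have hwp : ∀ j ≤ q - 1, w ^ j ∈ M := fun j hj => by simpa using hI j 0 hj (by omega)
  have hvq : v ^ q ∈ M := by
    have := hu (q - 1) le_rfl
    rw [show q - 1 + 1 = q by omega, show q - (q - 1) - 1 = 0 by omega,
      show q - (q - 1) = 1 by omega, hq1] at this
    have e : v ^ q = c * u ^ q - δ ^ (q - 1) * w ^ 1 := by linear_combination -this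
    rw [e]
    exact M.sub_mem (mc _ (hup _ le_rfl)) (pδ _ _ (hwp 1 (by omega)))
  have hwq : w ^ q ∈ M := by
    have := hu 0 (by omega)
    simp only [Nat.sub_zero, zero_add, pow_zero, h0] at this
    have e : w ^ q = cs * u ^ q - δs ^ (q - 1) * v ^ 1 := by linear_combination -this
    rw [e]
    exact M.sub_mem (mcs _ (hup _ le_rfl)) (pδs _ _ (hvp 1 (by omega)))
  have hvp' : ∀ j ≤ q, v ^ j ∈ M := fun j hj => by
    rcases hj.eq_or_lt with rfl | hj
    · exact hvq
    · exact hvp j (by omega)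
  have hwp' : ∀ j ≤ q, w ^ j ∈ M := fun j hj => by
    rcases hj.eq_or_lt with rfl | hj
    · exact hwq
    · exact hwp j (by omega)
  have hhu : ∀ s ≤ q - 1, ∀ k ≤ q, h s * u ^ k ∈ M := by
    intro s hs k hk
    rcases Nat.eq_zero_or_pos s with rfl | hs0
    · rw [h0]; exact mcs _ (hup _ hk)
    rcases hs.eq_or_lt with rfl | hs1
    · rw [hq1]; exact mc _ (hup _ hk)
    rcases hk.eq_or_lt with rfl | hk1
    · rw [mul_comm, hu s hs, mul_comm, mul_comm (w ^ _)]
      exact M.add_mem (pδs _ _ (hvp _ (by omega))) (pδ _ _ (hwp _ (by omega)))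
    · exact hIII s k hs0 (by omega) (by omega)
  -- products of `h s` with powers of `w` and of `v`
  have hhw : ∀ s ≤ q - 2, ∀ i ≤ q - 1, h s * w ^ i ∈ M := by
    intro s
    induction s with
    | zero => intro _ i hi; rw [h0]; exact mcs _ (hwp _ hi)
    | succ s ih =>
      intro hs i hi
      rcases i with _ | i
      · simpa using hhu (s + 1) (by omega) 0 (by omega)
      · have e : h (s + 1) * w ^ (i + 1) = δ * (h s * w ^ i) +
            δs ^ (q - s - 2) * (w ^ i * v ^ (s + 1) * u ^ 1) := by
          linear_combination w ^ i * hw s (by omega)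
        rw [e]
        exact M.add_mem (mδ _ (ih (by omega) i (by omega)))
          (pδs _ _ (hII _ _ _ (by omega) (by omega) le_rfl (by omega)))
  have hhv : ∀ t ≤ q - 2, ∀ i ≤ q - 1, h (q - 1 - t) * v ^ i ∈ M := by
    intro t
    induction t with
    | zero => intro _ i hi; rw [Nat.sub_zero, hq1]; exact mc _ (hvp _ hi)
    | succ t ih =>
      intro ht i hi
      rcases i with _ | i
      · simpa using hhu (q - 1 - (t + 1)) (by omega) 0 (by omega)
      · have h1 := hv (q - 1 - (t + 1)) (by omega)
        rw [show q - 1 - (t + 1) + 1 = q - 1 - t by omega] at h1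
        have e : h (q - 1 - (t + 1)) * v ^ (i + 1) = δs * (h (q - 1 - t) * v ^ i) +
            δ ^ (q - 1 - (t + 1)) * (w ^ (q - (q - 1 - (t + 1)) - 1) * v ^ i * u ^ 1) := by
          linear_combination v ^ i * h1
        rw [e]
        exact M.add_mem (mδs _ (ih (by omega) i (by omega)))
          (pδ _ _ (hII _ _ _ (by omega) (by omega) le_rfl (by omega)))
  have hu_mem : ∀ m ∈ M, u * m ∈ M := by
    refine hspan u ?_ ?_ ?_
    · intro i j hi hj
      rcases hj.eq_or_lt with rfl | hj1
      · have h1 := hw (q - 2) (by omega)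
        rw [show q - 2 + 1 = q - 1 by omega, hq1, show q - (q - 2) - 2 = 0 by omega] at h1
        have e : u * (w ^ i * v ^ (q - 1)) = c * w ^ (i + 1) - δ * (h (q - 2) * w ^ i) := by
          linear_combination -w ^ i * h1
        rw [e]
        exact M.sub_mem (mc _ (hwp' _ (by omega))) (mδ _ (hhw _ le_rfl _ hi))
      rcases hi.eq_or_lt with rfl | hi1
      · have h1 := hv 0 (by omega)
        rw [h0] at h1
        have e : u * (w ^ (q - 1) * v ^ j) = cs * v ^ (j + 1) - δs * (h 1 * v ^ j) := by
          simp only [Nat.sub_zero, zero_add] at h1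
          linear_combination -v ^ j * h1
        have h2 := hhv (q - 2) le_rfl j hj
        rw [show q - 1 - (q - 2) = 1 by omega] at h2
        rw [e]
        exact M.sub_mem (mcs _ (hvp' _ (by omega))) (mδs _ h2)
      · have := hII i j 1 (by omega) (by omega) le_rfl (by omega)
        rwa [mul_comm, ← pow_one u]
    · intro i j k hi hj hk1 hk
      rcases hk.eq_or_lt with rfl | hk2
      · have e : u * (w ^ i * v ^ j * u ^ k) =
            w ^ (i + 1) * v ^ (j + 1) - δ * (δs * (w ^ i * v ^ j)) := by
          linear_combination -w ^ i * v ^ j * hvw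
        rw [e]
        exact M.sub_mem (hI _ _ (by omega) (by omega)) (mδ _ (mδs _ (hI _ _ (by omega) (by omega))))
      · have := hII i j (k + 1) hi hj (by omega) (by omega)
        rwa [show u * (w ^ i * v ^ j * u ^ k) = w ^ i * v ^ j * u ^ (k + 1) by ring]
    · intro s k hs1 hs hk
      have := hhu s (by omega) (k + 1) (by omega)
      rwa [show u * (h s * u ^ k) = h s * u ^ (k + 1) by ring]
  have pu : ∀ n, ∀ m ∈ M, u ^ n * m ∈ M := by
    intro n; induction n with
    | zero => simp
    | succ n ih => intro m hm; rw [pow_succ, mul_assoc]; exact ih _ (hu_mem m hm)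
  refine ⟨hu_mem, hspan v ?_ ?_ ?_⟩
  · intro i j hi hj
    rcases hj.eq_or_lt with rfl | hj1
    · have h1 := hu (q - 1) le_rfl
      rw [show q - 1 + 1 = q by omega, show q - (q - 1) - 1 = 0 by omega,
        show q - (q - 1) = 1 by omega, hq1] at h1
      have e : v * (w ^ i * v ^ (q - 1)) = c * (u ^ q * w ^ i) - δ ^ (q - 1) * w ^ (i + 1) := by
        have h2 : v ^ q = v * v ^ (q - 1) := by rw [← pow_succ', Nat.sub_add_cancel (by omega)]
        linear_combination -w ^ i * h1 - w ^ i * h2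
      rw [e]
      exact M.sub_mem (mc _ (pu _ _ (hwp _ hi))) (pδ _ _ (hwp' _ (by omega)))
    · have := hI i (j + 1) hi (by omega)
      rwa [show v * (w ^ i * v ^ j) = w ^ i * v ^ (j + 1) by ring]
  · intro i j k hi hj hk1 hk
    rw [show v * (w ^ i * v ^ j * u ^ k) = u ^ k * (w ^ i * v ^ (j + 1)) by ring]
    exact pu _ _ (hI _ _ (by omega) (by omega))
  · intro s k hs1 hs hk
    have e : v * (h s * u ^ k) = δs * (h (s + 1) * u ^ k) +
        δ ^ s * (u ^ (k + 1) * w ^ (q - s - 1)) := by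
      linear_combination u ^ k * hv s (by omega)
    rw [e]
    exact M.add_mem (mδs _ (hhu _ (by omega) _ (by omega))) (pδ _ _ (pu _ _ (hwp _ (by omega))))

namespace Polynomial

section Division

variable {F : Type*} [Field F] [Fintype F] {A : Type*} [CommRing A] [Algebra F A]

theorem add_pow_fieldCard (x y : A) :
    (x + y) ^ Fintype.card F = x ^ Fintype.card F + y ^ Fintype.card F :=
  map_add (FiniteField.frobeniusAlgHom F A) x y

theorem sub_pow_fieldCard (x y : A) :
    (x - y) ^ Fintype.card F = x ^ Fintype.card F - y ^ Fintype.card F :=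
  map_sub (FiniteField.frobeniusAlgHom F A) x y

theorem algebraMap_pow_fieldCard (b : F) :
    (algebraMap F A b) ^ Fintype.card F = algebraMap F A b := by
  rw [← map_pow, FiniteField.pow_card]

theorem smul_sub_pow_fieldCard_pow (n : ℕ) (a b : F) (x y : A) :
    (a • x - b • y) ^ Fintype.card F ^ n =
      a • x ^ Fintype.card F ^ n - b • y ^ Fintype.card F ^ n := by
  induction n with
  | zero => simp
  | succ n ih =>
    rw [pow_succ, pow_mul, ih, sub_pow_fieldCard (F := F)]
    simp only [Algebra.smul_def, mul_pow, algebraMap_pow_fieldCard, pow_mul]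

theorem skew_pow_eq {a b c d : F} (h : a * d - b * c = 1) (n : ℕ) (x y : A) :
    (a • y - b • x) * (d • x - c • y) ^ Fintype.card F ^ n -
      (d • x - c • y) * (a • y - b • x) ^ Fintype.card F ^ n =
      y * x ^ Fintype.card F ^ n - x * y ^ Fintype.card F ^ n := by
  rw [smul_sub_pow_fieldCard_pow, smul_sub_pow_fieldCard_pow]
  have h' := congrArg (algebraMap F A) h
  simp only [map_sub, map_mul, map_one] at h'
  simp only [Algebra.smul_def]
  linear_combination (y * x ^ Fintype.card F ^ n - x * y ^ Fintype.card F ^ n) * h'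

/-- The orbit product of the indeterminate under translations by `F`-multiples of `a`. -/
def orbitProd (q : ℕ) (a : A) : A[X] := X ^ q - C (a ^ (q - 1)) * X

theorem orbitProd_monic [Nontrivial A] {q : ℕ} (hq : 2 ≤ q) (a : A) : (orbitProd q a).Monic := by
  apply monic_X_pow_sub
  refine lt_of_le_of_lt (degree_C_mul_X_le _) ?_
  exact_mod_cast hq

theorem orbitProd_natDegree [Nontrivial A] {q : ℕ} (hq : 2 ≤ q) (a : A) :
    (orbitProd q a).natDegree = q := by
  apply natDegree_eq_of_degree_eq_some
  unfold orbitProd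
  rw [degree_sub_eq_left_of_degree_lt, degree_X_pow]
  rw [degree_X_pow]
  refine lt_of_le_of_lt (degree_C_mul_X_le _) ?_
  exact_mod_cast hq

theorem taylor_orbitProd (a : A) (b : F) :
    taylor (b • a) (orbitProd (Fintype.card F) a) = orbitProd (Fintype.card F) a := by
  have hq : Fintype.card F - 1 + 1 = Fintype.card F := Nat.sub_add_cancel Fintype.card_pos
  simp only [orbitProd, map_sub, taylor_mul, taylor_pow, taylor_X, taylor_C]
  rw [add_pow_fieldCard (F := F), ← C_pow, Algebra.smul_def, mul_pow, algebraMap_pow_fieldCard]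
  have : a ^ Fintype.card F = a ^ (Fintype.card F - 1) * a := by rw [← pow_succ, hq]
  rw [this]
  simp only [C_mul]
  ring

variable [IsDomain A]

theorem modByMonic_orbitProd {a : A} (ha : a ≠ 0) {f : A[X]}
    (hf : ∀ b : F, taylor (b • a) f = f) :
    (∀ b : F, taylor (b • a) (f /ₘ orbitProd (Fintype.card F) a) =
      f /ₘ orbitProd (Fintype.card F) a) ∧
    f = orbitProd (Fintype.card F) a * (f /ₘ orbitProd (Fintype.card F) a) + C (f.eval 0) := by
  set N := orbitProd (Fintype.card F) a with hN
  have hq : 2 ≤ Fintype.card F := Fintype.one_lt_card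
  have hmon : N.Monic := orbitProd_monic hq a
  have hdeg : N.natDegree = Fintype.card F := orbitProd_natDegree hq a
  have key : ∀ b : F, f /ₘ N = taylor (b • a) (f /ₘ N) ∧ f %ₘ N = taylor (b • a) (f %ₘ N) := by
    intro b
    refine div_modByMonic_unique _ _ hmon ⟨?_, ?_⟩
    · conv_rhs => rw [← hf b]
      conv_rhs => rw [← modByMonic_add_div f N]
      rw [map_add, taylor_mul, taylor_orbitProd]
    · rw [degree_taylor]
      exact degree_modByMonic_lt _ hmon
  have hr : f %ₘ N = C ((f %ₘ N).eval 0) := by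
    rw [← sub_eq_zero]
    refine eq_zero_of_natDegree_lt_card_of_eval_eq_zero _ (f := fun b : F => b • a) ?_ ?_ ?_
    · intro b b' h
      exact smul_left_injective F ha h
    · intro b
      have := congrArg (eval 0) (key b).2
      rw [taylor_eval, zero_add] at this
      simp [← this]
    · have h1 : (f %ₘ N).natDegree < Fintype.card F := by
        rw [← hdeg]
        exact natDegree_modByMonic_lt _ hmon (by intro h; rw [h, natDegree_one] at hdeg; omega)
      exact by rwa [natDegree_sub_C]
  refine ⟨fun b => (key b).1.symm, ?_⟩
  have h0 : f.eval 0 = (f %ₘ N).eval 0 := by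
    conv_lhs => rw [← modByMonic_add_div f N]
    have : N.eval 0 = 0 := by simp [hN, orbitProd, show Fintype.card F ≠ 0 by omega]
    simp [this]
  rw [h0, ← hr]
  conv_lhs => rw [← modByMonic_add_div f N, add_comm]

theorem exists_comp_orbitProd {a : A} (ha : a ≠ 0) {f : A[X]}
    (hf : ∀ b : F, taylor (b • a) f = f) :
    ∃ g : A[X], f = g.comp (orbitProd (Fintype.card F) a) := by
  have hq : 2 ≤ Fintype.card F := Fintype.one_lt_card
  induction hn : f.natDegree using Nat.strong_induction_on generalizing f with
  | _ n ih =>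
    rcases Nat.eq_zero_or_pos n with rfl | hpos
    · rw [eq_C_of_natDegree_eq_zero hn]
      exact ⟨C (f.coeff 0), by simp⟩
    · obtain ⟨h1, h2⟩ := modByMonic_orbitProd ha hf
      obtain ⟨g, hg⟩ := ih _ (by
        rw [natDegree_divByMonic _ (orbitProd_monic hq a), orbitProd_natDegree hq]; omega) h1 rfl
      refine ⟨X * g + C (f.eval 0), ?_⟩
      rw [add_comp, mul_comp, X_comp, C_comp, ← hg]
      exact h2

end Division

section Dickson

variable {F : Type*} [Field F] [Fintype F] {k : Type*} [CommRing k] [IsDomain k] [Algebra F k]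

/-- The substitution `x₁ ↦ d x₁ - c x₂`, `x₂ ↦ a x₂ - b x₁` on `k[x₁][x₂]`. -/
def polyAct (k : Type*) [CommRing k] [Algebra F k] (a b c d : F) : k[X][X] →ₐ[k] k[X][X] :=
  aevalAeval (d • C X - c • X) (a • X - b • C X)

omit [Fintype F] [IsDomain k] in
@[simp] theorem polyAct_C_X (a b c d : F) : polyAct k a b c d (C X) = d • C X - c • X := by
  rw [polyAct, aevalAeval_X]

omit [Fintype F] [IsDomain k] in
@[simp] theorem polyAct_C_C (a b c d : F) (x : k) : polyAct k a b c d (C (C x)) = C (C x) :=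
  (polyAct k a b c d).commutes x

omit [Fintype F] [IsDomain k] in
@[simp] theorem polyAct_X (a b c d : F) : polyAct k a b c d X = a • X - b • C X := by
  rw [polyAct, aevalAeval_Y]

theorem mem_adjoin_of_polyAct_eq {c : k[X][X]}
    (hc : (X * C X ^ Fintype.card F - C X * X ^ Fintype.card F) * c =
      X * C X ^ (Fintype.card F ^ 2) - C X * X ^ (Fintype.card F ^ 2))
    {f : k[X][X]} (hf : ∀ a b c d : F, a * d - b * c = 1 → polyAct k a b c d f = f) :
    f ∈ Algebra.adjoin k
      {(X * C X ^ Fintype.card F - C X * X ^ Fintype.card F : k[X][X]), c} := by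
  set q := Fintype.card F with hqdef
  have hq : 2 ≤ q := Fintype.one_lt_card
  set δ : k[X][X] := X * C X ^ q - C X * X ^ q with hδ
  have hqq : q ^ 2 - q + q = q ^ 2 := Nat.sub_add_cancel (Nat.le_self_pow (by norm_num) q)
  have hCX : (C X : k[X][X]) ≠ 0 := by simp
  set N := orbitProd q (X : k[X]) with hN
  have hmon : N.Monic := orbitProd_monic hq _
  have hdeg : N.natDegree = q := orbitProd_natDegree hq _
  have hδN : δ = - (C X * N) := by
    have : (C X : k[X][X]) ^ q = C X ^ (q - 1) * C X := by
      rw [← pow_succ, Nat.sub_add_cancel (by omega)]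
    rw [hδ, this, hN, orbitProd, C_pow]; ring
  have hNc : N * c = X ^ q ^ 2 - C X ^ (q ^ 2 - 1) * X := by
    have : (C X : k[X][X]) ^ q ^ 2 = C X ^ (q ^ 2 - 1) * C X := by
      rw [← pow_succ, Nat.sub_add_cancel (Nat.pos_of_ne_zero (by positivity))]
    apply mul_left_cancel₀ hCX
    rw [hδN, this] at hc
    linear_combination -hc
  have hcdeg : c.natDegree ≤ q ^ 2 - q := by
    rcases eq_or_ne c 0 with rfl | hc0
    · simp
    have h1 : (N * c).natDegree = q + c.natDegree := by
      rw [natDegree_mul hmon.ne_zero hc0, hdeg]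
    have h2 : (N * c).natDegree ≤ q ^ 2 := by
      rw [hNc]
      refine (natDegree_sub_le _ _).trans (max_le (natDegree_X_pow_le _) ?_)
      rw [← C_pow]
      exact (natDegree_C_mul_le _ _).trans (by rw [natDegree_X]; nlinarith)
    omega
  set ev : k[X][X] →+* k[X] := mapRingHom (evalRingHom 0) with hev
  have evN : ev N = X ^ q := by
    simp [hev, hN, orbitProd, show q - 1 ≠ 0 by omega]
  have evc : ev c = X ^ (q ^ 2 - q) := by
    have := congrArg ev hNc
    rw [map_mul, evN, map_sub, map_mul, map_pow, map_pow] at this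
    have e1 : ev X = X := by simp [hev]
    have e2 : ev (C X) = 0 := by simp [hev]
    have e3 : q ^ 2 - 1 ≠ 0 := by nlinarith [Nat.sub_add_cancel (show 1 ≤ q ^ 2 by nlinarith)]
    rw [e1, e2, zero_pow e3, zero_mul, sub_zero, ← hqq, pow_add, mul_comm] at this
    exact mul_right_cancel₀ (pow_ne_zero _ X_ne_zero) this
  have hδinv : ∀ a b c d : F, a * d - b * c = 1 → polyAct k a b c d δ = δ := by
    intro a b c d h
    have := skew_pow_eq (A := k[X][X]) h 1 (C X) X
    rw [pow_one] at this
    rw [hδ, map_sub, map_mul, map_mul, map_pow, map_pow, polyAct_C_X, polyAct_X, this]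
  have hδ0 : δ ≠ 0 := by rw [hδN, neg_ne_zero]; exact mul_ne_zero hCX hmon.ne_zero
  have hcinv : ∀ a b c' d : F, a * d - b * c' = 1 → polyAct k a b c' d c = c := by
    intro a b c' d h
    have h1 := congrArg (polyAct k a b c' d) hc
    have h2 := skew_pow_eq (A := k[X][X]) h 2 (C X) X
    rw [map_mul, hδinv _ _ _ _ h, map_sub, map_mul, map_mul, map_pow, map_pow, polyAct_C_X,
      polyAct_X, h2, ← hc] at h1
    exact mul_left_cancel₀ hδ0 h1
  have htaylor : ∀ (g : k[X][X]) (b : F),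
      polyAct k 1 (-b) 0 1 g = taylor (b • (X : k[X])) g := by
    intro g b
    have : polyAct k 1 (-b) 0 1 = (taylorAlgHom (b • (X : k[X]))).restrictScalars k := by
      apply Polynomial.algHom_ext'
      · apply Polynomial.algHom_ext
        simp
      · simp
    rw [this]; rfl
  induction hn : f.natDegree using Nat.strong_induction_on generalizing f with
  | _ n ih =>
  have hU : ∀ b : F, taylor (b • (X : k[X])) f = f := by
    intro b
    rw [← htaylor, hf 1 (-b) 0 1 (by ring)]
  set p := ev f with hp
  have hpq : ∀ i, p.coeff i ≠ 0 → q ∣ i := by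
    obtain ⟨g, hg⟩ := exists_comp_orbitProd X_ne_zero hU
    intro i hi
    have : p = expand k q (g.map (evalRingHom 0)) := by
      rw [hp, hg, expand_eq_comp_X_pow, ← evN, hev]
      exact map_comp _ _ _
    rw [this, coeff_expand (by omega)] at hi
    by_contra h
    simp [h] at hi
  have hpq1 : ∀ i, p.coeff i ≠ 0 → q - 1 ∣ i := by
    intro i hi
    rw [hqdef, ← FiniteField.forall_pow_eq_one_iff]
    intro t
    have := hf t 0 0 (↑t⁻¹) (by simp)
    have h2 : p.comp (C (algebraMap F k t) * X) = p := by
      have e : ev (polyAct k (t : F) 0 0 (↑t⁻¹ : F) f) =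
          (ev f).comp (C (algebraMap F k t) * X) := by
        have : ev.comp (polyAct k (t : F) 0 0 (↑t⁻¹ : F)).toRingHom =
            (compRingHom (C (algebraMap F k t) * X)).comp ev := by
          apply Polynomial.ringHom_ext'
          · apply Polynomial.ringHom_ext
            · intro x; simp [hev]
            · simp [hev]
          · simp [hev, Algebra.smul_def]
        exact RingHom.congr_fun this f
      rw [hp, ← e, this]
    have h3 := congrArg (fun z => coeff z i) h2
    simp only [comp_C_mul_X_coeff] at h3
    have h4 : algebraMap F k t ^ i = 1 := mul_left_cancel₀ hi (by rw [h3, mul_one])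
    rw [← map_pow, ← map_one (algebraMap F k)] at h4
    exact Units.ext (by simpa using (algebraMap F k).injective h4)
  set p' := contract (q ^ 2 - q) p with hp'
  have hpos : q ^ 2 - q ≠ 0 := by
    have : q < q ^ 2 := by nlinarith
    omega
  have hpp : expand k (q ^ 2 - q) p' = p := by
    ext i
    rw [coeff_expand (Nat.pos_of_ne_zero hpos), hp', coeff_contract hpos]
    split_ifs with h
    · rw [Nat.div_mul_cancel h]
    · by_contra h2
      apply h
      have e : q ^ 2 - q = q * (q - 1) := by rw [Nat.mul_sub]; ring_nf
      rw [e]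
      refine Nat.Coprime.mul_dvd_of_dvd_of_dvd ?_ (hpq i (Ne.symm h2)) (hpq1 i (Ne.symm h2))
      rw [Nat.coprime_self_sub_right (by omega)]
      exact Nat.coprime_one_right q
  have hfc : (aeval c p').natDegree ≤ f.natDegree := by
    have e : aeval c p' = (p'.map C).comp c := by
      rw [comp, eval₂_map, aeval_def]; rfl
    have h1 : p.natDegree = p'.natDegree * (q ^ 2 - q) := by rw [← hpp, natDegree_expand]
    have h2 : p.natDegree ≤ f.natDegree := natDegree_map_le
    calc _ ≤ (p'.map C).natDegree * c.natDegree := by rw [e]; exact natDegree_comp_le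
      _ ≤ p'.natDegree * (q ^ 2 - q) := Nat.mul_le_mul natDegree_map_le hcdeg
      _ ≤ _ := by omega
  have evp : ev (aeval c p') = p := by
    rw [← hpp, aeval_def, hom_eval₂, evc, expand_eq_comp_X_pow, comp]
    congr 1
    ext x; simp [hev]
  have hcmem : aeval c p' ∈ Algebra.adjoin k {δ, c} :=
    Algebra.adjoin_mono (by simp) (aeval_mem_adjoin_singleton k c (p := p'))
  set f₁ := f - aeval c p' with hf₁
  have hf₁inv : ∀ a b c d : F, a * d - b * c = 1 → polyAct k a b c d f₁ = f₁ := by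
    intro a b c' d h
    rw [hf₁, map_sub, hf _ _ _ _ h, ← aeval_algHom_apply, hcinv _ _ _ _ h]
  have ev₁ : ev f₁ = 0 := by rw [hf₁, map_sub, evp, sub_self]
  suffices h : f₁ ∈ Algebra.adjoin k {δ, c} by
    have := add_mem h hcmem
    rwa [hf₁, sub_add_cancel] at this
  have hU₁ : ∀ b : F, taylor (b • (X : k[X])) f₁ = f₁ := by
    intro b
    rw [← htaylor, hf₁inv 1 (-b) 0 1 (by ring)]
  have h0 : f₁.eval 0 = 0 := by
    have := hf₁inv 0 1 (-1) 0 (by ring)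
    have e : (polyAct k 0 1 (-1 : F) 0 f₁).eval 0 = (ev f₁).comp (-X) := by
      have : (evalRingHom 0).comp (polyAct k 0 1 (-1 : F) 0).toRingHom =
          (compRingHom (-X)).comp ev := by
        apply Polynomial.ringHom_ext'
        · apply Polynomial.ringHom_ext
          · intro x; simp [hev]
          · simp [hev]
        · simp [hev]
      exact RingHom.congr_fun this f₁
    rw [← this, e, ev₁, zero_comp]
  obtain ⟨-, hdiv⟩ := modByMonic_orbitProd X_ne_zero hU₁
  rw [h0, C_0, add_zero] at hdiv
  set Q := f₁ /ₘ N with hQ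
  have evQ : ev Q = 0 := by
    have := congrArg ev hdiv
    rw [ev₁, map_mul, ← hqdef, ← hN, evN] at this
    exact (mul_eq_zero.mp this.symm).resolve_left (pow_ne_zero _ X_ne_zero)
  obtain ⟨Q', hQ'⟩ : C X ∣ Q := by
    rw [C_dvd_iff_dvd_coeff]
    intro i
    rw [X_dvd_iff]
    have := congrArg (fun z => coeff z i) evQ
    simpa [hev, coeff_zero_eq_eval_zero] using this
  have hfQ : f₁ = δ * (-Q') := by rw [hdiv, hQ', hδN, ← hqdef, ← hN]; ring
  rcases eq_or_ne Q' 0 with h | hne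
  · rw [hfQ, h]; simp
  rw [hfQ]
  refine mul_mem (Algebra.subset_adjoin (by simp)) (ih (-Q').natDegree ?_ ?_ rfl)
  · have h1 : f₁.natDegree = q + Q'.natDegree := by
      rw [hdiv, hQ', ← hqdef, ← hN, natDegree_mul hmon.ne_zero (mul_ne_zero hCX hne), hdeg,
        natDegree_C_mul X_ne_zero]
    have h2 : f₁.natDegree ≤ f.natDegree := by
      exact (natDegree_sub_le _ _).trans (max_le le_rfl hfc)
    rw [natDegree_neg]; omega
  · intro a b c' d h
    have := hf₁inv a b c' d h
    rw [hfQ, map_mul, hδinv _ _ _ _ h] at this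
    exact mul_left_cancel₀ hδ0 this

end Dickson

end Polynomial

namespace Polynomial

section Independence

variable {E : Type*} [CommRing E] [IsDomain E] {ι Λ : Type*} [Fintype ι] [Fintype Λ]

omit [Fintype ι] in
/-- If a domain `E` has enough endomorphisms fixing `K` and moving `z`, then powers of `z` with
exponents in a short window are independent over `K`. -/
theorem eq_zero_of_sum_mul_pow_eq_zero (K : Subring E) {z : E} {z' : Λ → E}
    (hz' : Function.Injective z') (hz0 : ∀ l, z' l ≠ 0)
    (hσ : ∀ l, ∃ σ : E →+* E, σ z = z' l ∧ ∀ x ∈ K, σ x = x)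
    {s : Finset ι} {b : ι → ℕ} (hb : Set.InjOn b s)
    (hw : ∀ m ∈ s, ∀ m' ∈ s, b m < b m' + Fintype.card Λ)
    {c : ι → E} (hc : ∀ m ∈ s, c m ∈ K) (hsum : ∑ m ∈ s, c m * z ^ b m = 0) :
    ∀ m ∈ s, c m = 0 := by
  intro m₀ hm₀
  obtain ⟨m₁, hm₁, hmin⟩ := s.exists_min_image b ⟨m₀, hm₀⟩
  set p : E[X] := ∑ m ∈ s, C (c m) * X ^ (b m - b m₁) with hp
  have hp0 : p = 0 := by
    refine eq_zero_of_natDegree_lt_card_of_eval_eq_zero p hz' ?_ ?_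
    · intro l
      obtain ⟨σ, hσz, hσK⟩ := hσ l
      have h1 := congrArg σ hsum
      rw [map_sum, map_zero] at h1
      apply (mul_eq_zero.mp _).resolve_left (pow_ne_zero (b m₁) (hz0 l))
      rw [hp, eval_finsetSum, Finset.mul_sum, ← h1]
      refine Finset.sum_congr rfl fun m hm => ?_
      rw [map_mul, map_pow, hσz, hσK _ (hc m hm), eval_mul, eval_C, eval_pow, eval_X,
        mul_left_comm, ← pow_add, Nat.add_sub_cancel' (hmin m hm)]
    · have hpos := hw m₁ hm₁ m₁ hm₁
      have : p.natDegree ≤ Fintype.card Λ - 1 := by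
        refine natDegree_sum_le_of_forall_le _ _ fun m hm => ?_
        refine (natDegree_C_mul_X_pow_le _ _).trans ?_
        have := hw m hm m₁ hm₁
        omega
      omega
  have := congrArg (fun r => coeff r (b m₀ - b m₁)) hp0
  simp only [hp, finsetSum_coeff, coeff_C_mul_X_pow, coeff_zero] at this
  rw [Finset.sum_eq_single_of_mem m₀ hm₀, if_pos rfl] at this
  · exact this
  · intro m hm hne
    rw [if_neg]
    intro h
    apply hne
    apply hb hm hm₀
    have h1 := hmin m hm
    have h2 := hmin m₀ hm₀
    omega

theorem eq_zero_of_sum_expand_mul_eq_zero (K : Subring E) {z : E} {z' : Λ → E}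
    (hz' : Function.Injective z') (hz0 : ∀ l, z' l ≠ 0)
    (hσ : ∀ l, ∃ σ : E →+* E, σ z = z' l ∧ ∀ x ∈ K, σ x = x)
    {L : ℕ} (hL : 0 < L) {a b e : ι → ℕ} {d : E} (hd : d ∈ K) (hd0 : d ≠ 0)
    (hb : ∀ m m', a m ≡ a m' [MOD L] → b m = b m' → m = m')
    (hw : ∀ m m', a m ≡ a m' [MOD L] → b m < b m' + Fintype.card Λ)
    {g : ι → E[X]} (hg : ∀ m n, (g m).coeff n ∈ K)
    (hsum : ∑ m, expand E L (g m) * (X ^ a m * C (z ^ b m * d ^ e m)) = 0) :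
    ∀ m, g m = 0 := by
  classical
  intro m₀
  ext n₀
  set N := a m₀ + L * n₀ with hN
  set s : Finset ι := Finset.univ.filter fun m => a m ≡ a m₀ [MOD L] with hs
  have hmem : ∀ m, (expand E L (g m) * X ^ a m).coeff N ∈ K := by
    intro m
    rw [coeff_mul_X_pow', coeff_expand hL]
    split_ifs
    · exact hg _ _
    · exact K.zero_mem
    · exact K.zero_mem
  have h1 := congrArg (fun r => coeff r N) hsum
  simp only [finsetSum_coeff, coeff_zero, ← mul_assoc, coeff_mul_C] at h1
  have h2 : ∑ m ∈ s, ((expand E L (g m) * X ^ a m).coeff N * d ^ e m) * z ^ b m = 0 := by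
    rw [← h1]
    rw [Finset.sum_subset (Finset.subset_univ s)]
    · refine Finset.sum_congr rfl fun m _ => by ring
    · intro m _ hm
      have : (expand E L (g m) * X ^ a m).coeff N = 0 := by
        rw [coeff_mul_X_pow', coeff_expand hL]
        split_ifs with h3 h4
        · exfalso
          apply hm
          rw [hs, Finset.mem_filter]
          refine ⟨Finset.mem_univ _, ?_⟩
          have h5 : a m ≡ N [MOD L] := (Nat.modEq_iff_dvd' h3).mpr h4
          refine h5.trans ?_
          rw [hN]
          simp [Nat.ModEq]
        · rfl
        · rfl
      rw [this]; simp
  have h3 := eq_zero_of_sum_mul_pow_eq_zero K hz' hz0 hσ (s := s) (b := b)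
    (fun m hm m' hm' h => hb m m' (by
      have h4 := (Finset.mem_filter.mp (Finset.mem_coe.mp hm)).2
      have h5 := (Finset.mem_filter.mp (Finset.mem_coe.mp hm')).2
      exact h4.trans h5.symm) h)
    (fun m hm m' hm' => hw m m'
      ((Finset.mem_filter.mp hm).2.trans (Finset.mem_filter.mp hm').2.symm))
    (fun m _ => K.mul_mem (hmem m) (K.pow_mem hd _)) h2 m₀ (by simp [hs, Nat.ModEq.refl])
  have h4 := (mul_eq_zero.mp h3).resolve_right (pow_ne_zero _ hd0)
  rw [hN, add_comm, coeff_mul_X_pow, coeff_expand_mul' hL] at h4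
  simpa using h4

end Independence

end Polynomial

section Index

/-- Index type for the module generators. -/
abbrev GenIdx (q : ℕ) : Type :=
  (Fin q × Fin q) ⊕ (Fin (q - 1) × Fin (q - 1) × Fin q) ⊕ (Fin (q - 2) × Fin q)

/-- The `x₂`-exponent of the reduction of a generator. -/
def xExp (q : ℕ) : GenIdx q → ℕ
  | .inl (i, j) => i + q * j
  | .inr (.inl (i, j, k)) => i + q * j + (k + 1)
  | .inr (.inr (s, k)) => q * (s + 1) + k

/-- The `y₂`-exponent of the reduction of a generator, shifted by `q - 1`. -/
def yExp (q : ℕ) : GenIdx q → ℕ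
  | .inl (i, j) => q * i + j + (q - 1)
  | .inr (.inl (i, j, k)) => q * i + j + (k + 1) + (q - 1)
  | .inr (.inr (s, k)) => (s + 1) + k

/-- The `d₂₂*`-exponent of the reduction of a generator. -/
def dExp (q : ℕ) : GenIdx q → ℕ
  | .inl _ => 0
  | .inr (.inl _) => 0
  | .inr (.inr (s, _)) => q - (s + 1) - 1

/-- Normal form `(r, t, ν)` of the exponents. -/
def expNF (q : ℕ) : GenIdx q → ℕ × ℕ × ℕ
  | .inl (i, j) => if (j : ℕ) = q - 1 then (i, 0, i + 2) else (i, j, i + 1)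
  | .inr (.inl (i, j, k)) =>
    if (i : ℕ) + (k + 1) < q then (i + (k + 1), j, i + 1)
    else if (j : ℕ) = q - 2 then (i + (k + 1) - q, 0, i + 3)
    else (i + (k + 1) - q, j + 1, i + 2)
  | .inr (.inr (s, k)) => (k, s + 1, 0)

theorem expNF_injective {q : ℕ} : Function.Injective (expNF q) := by
  rintro (⟨⟨i, hi⟩, ⟨j, hj⟩⟩ | ⟨⟨i, hi⟩, ⟨j, hj⟩, ⟨k, hk⟩⟩ | ⟨⟨s, hs⟩, ⟨k, hk⟩⟩)
    (⟨⟨i', hi'⟩, ⟨j', hj'⟩⟩ | ⟨⟨i', hi'⟩, ⟨j', hj'⟩, ⟨k', hk'⟩⟩ | ⟨⟨s', hs'⟩, ⟨k', hk'⟩⟩) h <;>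
    simp only [expNF] at h <;> (try split_ifs at h) <;>
    simp only [Prod.mk.injEq, Sum.inl.injEq, Sum.inr.injEq, Fin.ext_iff, reduceCtorEq] at h ⊢
  all_goals first | omega | exact absurd h (by simp)

theorem expNF_spec {q : ℕ} (hq : 2 ≤ q) (m : GenIdx q) :
    (∃ ε, xExp q m = (expNF q m).1 + q * (expNF q m).2.1 + (q ^ 2 - q) * ε) ∧
    (expNF q m).1 < q ∧ (expNF q m).2.1 < q - 1 ∧
    yExp q m = (expNF q m).1 + (expNF q m).2.1 + (q - 1) * (expNF q m).2.2 ∧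
    ((expNF q m).2.1 = 0 → 1 ≤ (expNF q m).2.2 ∧ (expNF q m).2.2 ≤ q + 1) ∧
    ((expNF q m).2.1 ≠ 0 → (expNF q m).2.2 ≤ q) := by
  obtain ⟨n, rfl⟩ : ∃ n, q = n + 2 := ⟨q - 2, by omega⟩
  have e1 : (n + 2) ^ 2 - (n + 2) = (n + 2) * (n + 1) := by
    rw [Nat.sub_eq_iff_eq_add (by nlinarith)]; ring
  rw [e1]
  rcases m with ⟨⟨i, hi⟩, ⟨j, hj⟩⟩ | ⟨⟨i, hi⟩, ⟨j, hj⟩, ⟨k, hk⟩⟩ | ⟨⟨s, hs⟩, ⟨k, hk⟩⟩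
  · simp only [expNF, xExp, yExp]
    split_ifs with h
    · have : j = n + 1 := by omega
      subst this
      refine ⟨⟨1, by simp⟩, hi, by simp, ?_, by dsimp only; omega, by simp⟩
      simp; ring
    · refine ⟨⟨0, by simp⟩, hi, by dsimp only; omega, ?_, by dsimp only; omega, by dsimp only; omega⟩
      simp; ring
  · simp only [expNF, xExp, yExp]
    split_ifs with h h2
    · refine ⟨⟨0, by ring⟩, h, hj, ?_, by dsimp only; omega, by dsimp only; omega⟩
      simp; ring
    · have : j = n := by omega
      subst this
      obtain ⟨r, hr⟩ : ∃ r, i + (k + 1) = r + (j + 2) := ⟨i + (k + 1) - (j + 2), by omega⟩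
      simp only [hr, Nat.add_sub_cancel]
      refine ⟨⟨1, ?_⟩, by omega, by omega, ?_, by omega,
        by omega⟩
      · linarith
      · simp; linarith
    · obtain ⟨r, hr⟩ : ∃ r, i + (k + 1) = r + (n + 2) := ⟨i + (k + 1) - (n + 2), by omega⟩
      simp only [hr, Nat.add_sub_cancel]
      refine ⟨⟨0, ?_⟩, by omega, by omega, ?_, by omega,
        by omega⟩
      · linarith
      · simp; linarith
  · simp only [expNF, xExp, yExp]
    exact ⟨⟨0, by ring⟩, hk, by omega, by ring, by simp, by omega⟩

theorem yExp_of_modEq {q : ℕ} (hq : 2 ≤ q) (m m' : GenIdx q)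
    (h : xExp q m ≡ xExp q m' [MOD (q ^ 2 - q)]) :
    (yExp q m = yExp q m' → m = m') ∧ yExp q m < yExp q m' + (q ^ 2 - 1) := by
  obtain ⟨⟨ε, hx⟩, hr, ht, hy, h0, h1⟩ := expNF_spec hq m
  obtain ⟨⟨ε', hx'⟩, hr', ht', hy', h0', h1'⟩ := expNF_spec hq m'
  have hinj := @expNF_injective q m m'
  generalize expNF q m = N at *
  generalize expNF q m' = N' at *
  obtain ⟨r, t, ν⟩ := N
  obtain ⟨r', t', ν'⟩ := N'
  simp only at *
  have e1 : q ^ 2 - q = q * (q - 1) := by rw [Nat.mul_sub]; ring_nf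
  have hlt : ∀ r t, r < q → t < q - 1 → r + q * t < q ^ 2 - q := by
    intro r t hr ht
    rw [e1]
    calc r + q * t < q * (t + 1) := by rw [Nat.mul_add]; omega
      _ ≤ _ := Nat.mul_le_mul_left _ (by omega)
  have h2 : r + q * t = r' + q * t' := by
    rw [hx, hx', Nat.ModEq, Nat.add_mul_mod_self_left, Nat.add_mul_mod_self_left,
      Nat.mod_eq_of_lt (hlt _ _ hr ht), Nat.mod_eq_of_lt (hlt _ _ hr' ht')] at h
    exact h
  have h3 : r = r' := by
    have := congrArg (· % q) h2
    simpa [Nat.mod_eq_of_lt hr, Nat.mod_eq_of_lt hr'] using this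
  subst h3
  have h4 : t = t' := Nat.eq_of_mul_eq_mul_left (by omega) (Nat.add_left_cancel h2)
  subst h4
  constructor
  · intro h5
    rw [hy, hy'] at h5
    have := Nat.eq_of_mul_eq_mul_left (by omega) (Nat.add_left_cancel h5)
    exact hinj (by rw [this])
  · rw [hy, hy']
    have h6 : ν ≤ ν' + q := by
      rcases Nat.eq_zero_or_pos t with h | h
      · have := h0 h; have := h0' h; omega
      · have := h1 h.ne'; omega
    have h7 : (q - 1) * ν ≤ (q - 1) * ν' + (q - 1) * q := by
      rw [← Nat.mul_add]; exact Nat.mul_le_mul_left _ h6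
    have h8 : (q - 1) * q < q ^ 2 - 1 := by
      rw [mul_comm, ← e1]
      have : q ≤ q ^ 2 := by nlinarith
      omega
    omega

theorem card_genIdx {q : ℕ} (hq : 2 ≤ q) : Fintype.card (GenIdx q) = q * (q ^ 2 - 1) := by
  simp only [Fintype.card_sum, Fintype.card_prod, Fintype.card_fin]
  obtain ⟨n, rfl⟩ : ∃ n, q = n + 2 := ⟨q - 2, by omega⟩
  have : (n + 2) ^ 2 - 1 = (n + 1) * (n + 3) := by
    rw [Nat.sub_eq_iff_eq_add (by nlinarith)]; ring
  rw [this]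
  simp only [Nat.add_sub_cancel, show n + 2 - 1 = n + 1 by omega]
  ring

end Index

section Relations

variable {F A : Type*} [Field F] [Fintype F] [CommRing A] [Algebra F A]

omit [Field F] [Algebra F A] in
theorem pow_card_sq (x : A) : x ^ Fintype.card F ^ 2 = (x ^ Fintype.card F) ^ Fintype.card F := by
  rw [← pow_mul, sq]

/-- The symplectic-type relation between the bilinear invariants. -/
theorem bilinear_mul_eq (x₁ x₂ y₁ y₂ : A) :
    (x₁ ^ Fintype.card F * y₁ + x₂ ^ Fintype.card F * y₂) *
        (x₁ * y₁ ^ Fintype.card F + x₂ * y₂ ^ Fintype.card F) =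
      (x₁ * y₁ + x₂ * y₂) ^ (Fintype.card F + 1) +
        (x₂ * x₁ ^ Fintype.card F - x₁ * x₂ ^ Fintype.card F) *
          (y₁ * y₂ ^ Fintype.card F - y₂ * y₁ ^ Fintype.card F) := by
  rw [pow_succ, Polynomial.add_pow_fieldCard (F := F), mul_pow, mul_pow]
  ring

theorem dickson_mul_bilinear_eq [IsDomain A] {x₁ x₂ c : A}
    (h0 : x₂ * x₁ ^ Fintype.card F - x₁ * x₂ ^ Fintype.card F ≠ 0)
    (hc : (x₂ * x₁ ^ Fintype.card F - x₁ * x₂ ^ Fintype.card F) * c =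
      x₂ * x₁ ^ Fintype.card F ^ 2 - x₁ * x₂ ^ Fintype.card F ^ 2) (y₁ y₂ : A) :
    (x₂ * x₁ ^ Fintype.card F - x₁ * x₂ ^ Fintype.card F) ^ (Fintype.card F - 1) *
        (x₁ * y₁ ^ Fintype.card F + x₂ * y₂ ^ Fintype.card F) =
      c * (x₁ * y₁ + x₂ * y₂) ^ Fintype.card F -
        (x₁ ^ Fintype.card F * y₁ + x₂ ^ Fintype.card F * y₂) ^ Fintype.card F := by
  apply mul_left_cancel₀ h0
  rw [← mul_assoc, ← pow_succ', Nat.sub_add_cancel Fintype.card_pos, mul_sub, ← mul_assoc, hc,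
    Polynomial.sub_pow_fieldCard (F := F), Polynomial.add_pow_fieldCard (F := F),
    Polynomial.add_pow_fieldCard (F := F), pow_card_sq, pow_card_sq]
  ring

theorem quotient_mul_eq [IsDomain A] {q : ℕ} {δ δs u v w : A} {h : ℕ → A} (hu0 : u ≠ 0)
    (hvw : v * w = u ^ (q + 1) + δ * δs)
    (hu : ∀ s ≤ q - 1, u ^ q * h s = v ^ (s + 1) * δs ^ (q - s - 1) + w ^ (q - s) * δ ^ s)
    {s : ℕ} (hs : s + 1 ≤ q - 1) :
    h s * v = δs * h (s + 1) + w ^ (q - s - 1) * δ ^ s * u ∧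
      h (s + 1) * w = δ * h s + v ^ (s + 1) * δs ^ (q - s - 2) * u := by
  obtain ⟨n, rfl⟩ : ∃ n, q = n + s + 2 := ⟨q - s - 2, by omega⟩
  have h1 := hu s (by omega)
  have h2 := hu (s + 1) hs
  rw [show n + s + 2 - s - 1 = n + 1 by omega, show n + s + 2 - s = n + 2 by omega] at h1
  rw [show n + s + 2 - (s + 1) - 1 = n by omega, show n + s + 2 - (s + 1) = n + 1 by omega] at h2
  rw [show n + s + 2 - s - 1 = n + 1 by omega, show n + s + 2 - s - 2 = n by omega]
  constructor
  · apply mul_left_cancel₀ (pow_ne_zero (n + s + 2) hu0)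
    linear_combination v * h1 - δs * h2 + w ^ (n + 1) * δ ^ s * hvw
  · apply mul_left_cancel₀ (pow_ne_zero (n + s + 2) hu0)
    linear_combination w * h2 - δ * h1 + v ^ (s + 1) * δs ^ n * hvw

end Relations

section Ring

variable {F : Type} [Field F]

theorem d22_ne_zero {q : ℕ} (hq : 2 ≤ q) : d22 F q ≠ 0 := by
  intro h
  have := congrArg (aeval (R := F) ![(Polynomial.X : Polynomial F), 1, 0, 0]) h
  simp only [d22, map_sub, map_mul, map_pow, aeval_X, map_zero, Matrix.cons_val_zero,
    Matrix.cons_val_one, one_mul, one_pow, mul_one] at this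
  have h2 := congrArg Polynomial.natDegree (sub_eq_zero.mp this)
  rw [Polynomial.natDegree_X_pow, Polynomial.natDegree_X] at h2
  omega

theorem d22s_ne_zero {q : ℕ} (hq : 2 ≤ q) : d22s F q ≠ 0 := by
  intro h
  have := congrArg (aeval (R := F) ![0, 0, 1, (Polynomial.X : Polynomial F)]) h
  simp only [d22s, map_sub, map_mul, map_pow, aeval_X, map_zero, Matrix.cons_val,
    one_mul, one_pow, mul_one] at this
  have h2 := congrArg Polynomial.natDegree (sub_eq_zero.mp this)
  rw [Polynomial.natDegree_X_pow, Polynomial.natDegree_X] at h2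
  omega

theorem u0_ne_zero : u0 F ≠ 0 := by
  intro h
  have := congrArg (aeval (R := F) ![(1 : F), 0, 1, 0]) h
  simp [u0] at this

end Ring

section Invariants

variable {F : Type} [Field F] [Fintype F]

local notation "𝔮" => Fintype.card F

/-- The defining equations of `c₂₁`, `c₂₁*` and the `h_s`. -/
structure DicksonData (c21 c21s : R2 F) (h : ℕ → R2 F) : Prop where
  mul_c21 : d22 F 𝔮 * c21 = X 1 * X 0 ^ 𝔮 ^ 2 - X 0 * X 1 ^ 𝔮 ^ 2
  mul_c21s : d22s F 𝔮 * c21s = X 2 * X 3 ^ 𝔮 ^ 2 - X 3 * X 2 ^ 𝔮 ^ 2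
  mul_h : ∀ s ≤ 𝔮 - 1, u0 F ^ 𝔮 * h s =
    u1 F 𝔮 ^ (s + 1) * d22s F 𝔮 ^ (𝔮 - s - 1) + u1s F 𝔮 ^ (𝔮 - s) * d22 F 𝔮 ^ s

theorem u1_mul_u1s :
    u1 F 𝔮 * u1s F 𝔮 = u0 F ^ (𝔮 + 1) + d22 F 𝔮 * d22s F 𝔮 :=
  bilinear_mul_eq _ _ _ _

namespace DicksonData

variable {c21 c21s : R2 F} {h : ℕ → R2 F} (D : DicksonData c21 c21s h)
include D

theorem h_zero : h 0 = c21s := by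
  apply mul_left_cancel₀ (pow_ne_zero 𝔮 (u0_ne_zero (F := F)))
  rw [D.mul_h 0 (Nat.zero_le _)]
  have := dickson_mul_bilinear_eq (F := F) (d22s_ne_zero (F := F) Fintype.one_lt_card)
    D.mul_c21s (X 1) (X 0)
  simp only [u0, u1, u1s, d22s, zero_add, pow_one, Nat.sub_zero, pow_zero, mul_one] at this ⊢
  rw [add_comm (X 0 * X 2), add_comm (X 0 ^ _ * X 2), add_comm (X 0 * _)]
  simp only [mul_comm (X 0 : R2 F), mul_comm (X 1 : R2 F), mul_comm ((X 0 : R2 F) ^ _),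
    mul_comm ((X 1 : R2 F) ^ _)]
  linear_combination this

theorem h_last : h (𝔮 - 1) = c21 := by
  apply mul_left_cancel₀ (pow_ne_zero 𝔮 (u0_ne_zero (F := F)))
  have hq : 1 < 𝔮 := Fintype.one_lt_card
  rw [D.mul_h (𝔮 - 1) le_rfl, show 𝔮 - 1 + 1 = 𝔮 by omega, show 𝔮 - (𝔮 - 1) = 1 by omega]
  have := dickson_mul_bilinear_eq (F := F) (d22_ne_zero (F := F) hq) D.mul_c21 (X 2) (X 3)
  simp only [u0, u1, u1s, d22, Nat.sub_self, pow_one, pow_zero, mul_one] at this ⊢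
  linear_combination this

theorem rel {s : ℕ} (hs : s + 1 ≤ 𝔮 - 1) :
    h s * u1 F 𝔮 = d22s F 𝔮 * h (s + 1) + u1s F 𝔮 ^ (𝔮 - s - 1) * d22 F 𝔮 ^ s * u0 F ∧
      h (s + 1) * u1s F 𝔮 = d22 F 𝔮 * h s + u1 F 𝔮 ^ (s + 1) * d22s F 𝔮 ^ (𝔮 - s - 2) * u0 F :=
  quotient_mul_eq u0_ne_zero u1_mul_u1s D.mul_h hs

end DicksonData

section Act

variable {A : GL (Fin 2) F} (hA : A ∈ SL2 F)
include hA

omit [Fintype F] in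
theorem det_eq_of_mem_SL2 : A.val 0 0 * A.val 1 1 - A.val 0 1 * A.val 1 0 = 1 := by
  rw [← Matrix.det_fin_two]; exact hA

omit [Fintype F] in
theorem act_X_of_mem_SL2 :
    act A (X 0) = A.val 1 1 • X 0 - A.val 1 0 • X 1 ∧
    act A (X 1) = A.val 0 0 • X 1 - A.val 0 1 • X 0 ∧
    act A (X 2) = A.val 0 0 • X 2 - (-A.val 0 1) • X 3 ∧
    act A (X 3) = A.val 1 1 • X 3 - (-A.val 1 0) • X 2 := by
  have hA' : A.val.det = 1 := hA
  simp only [act, aeval_X, hA', smul_eq_C_mul]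
  refine ⟨by simp, by simp, by simp, by simp [add_comm]⟩

theorem act_d22 : act A (d22 F 𝔮) = d22 F 𝔮 := by
  obtain ⟨h0, h1, -, -⟩ := act_X_of_mem_SL2 hA
  have := Polynomial.skew_pow_eq (det_eq_of_mem_SL2 hA) 1 (X 0 : R2 F) (X 1)
  simpa only [d22, map_sub, map_mul, map_pow, h0, h1, pow_one] using this

theorem act_d22s : act A (d22s F 𝔮) = d22s F 𝔮 := by
  obtain ⟨-, -, h2, h3⟩ := act_X_of_mem_SL2 hA
  have hd := det_eq_of_mem_SL2 hA
  rw [← neg_mul_neg (A.val 0 1)] at hd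
  have := Polynomial.skew_pow_eq hd 1 (X 3 : R2 F) (X 2)
  simpa only [d22s, map_sub, map_mul, map_pow, h2, h3, pow_one] using this

theorem act_bilinear (m n : ℕ) :
    act A (X 0 ^ 𝔮 ^ m * X 2 ^ 𝔮 ^ n + X 1 ^ 𝔮 ^ m * X 3 ^ 𝔮 ^ n) =
      X 0 ^ 𝔮 ^ m * X 2 ^ 𝔮 ^ n + X 1 ^ 𝔮 ^ m * X 3 ^ 𝔮 ^ n := by
  obtain ⟨h0, h1, h2, h3⟩ := act_X_of_mem_SL2 hA
  have hd := congrArg (C (σ := Fin 4)) (det_eq_of_mem_SL2 hA)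
  simp only [map_sub, map_mul, map_one] at hd
  simp only [map_add, map_mul, map_pow, h0, h1, h2, h3,
    Polynomial.smul_sub_pow_fieldCard_pow]
  simp only [smul_eq_C_mul, map_neg]
  linear_combination (X 0 ^ 𝔮 ^ m * X 2 ^ 𝔮 ^ n + X 1 ^ 𝔮 ^ m * X 3 ^ 𝔮 ^ n) * hd

theorem act_u0 : act A (u0 F) = u0 F := by
  simpa [u0] using act_bilinear hA 0 0

theorem act_u1 : act A (u1 F 𝔮) = u1 F 𝔮 := by
  simpa [u1] using act_bilinear hA 1 0

theorem act_u1s : act A (u1s F 𝔮) = u1s F 𝔮 := by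
  simpa [u1s] using act_bilinear hA 0 1

theorem DicksonData.act_h {c21 c21s : R2 F} {h : ℕ → R2 F} (D : DicksonData c21 c21s h) {s : ℕ}
    (hs : s ≤ 𝔮 - 1) : act A (h s) = h s := by
  apply mul_left_cancel₀ (pow_ne_zero 𝔮 (u0_ne_zero (F := F)))
  have := congrArg (act A) (D.mul_h s hs)
  simp only [map_add, map_mul, map_pow, act_u0 hA, act_u1 hA, act_u1s hA, act_d22 hA,
    act_d22s hA] at this
  rw [this, D.mul_h s hs]

end Act

end Invariants

namespace Polynomial

theorem eq_zero_of_sum_eval₂_mul_eq_zero {B S ι : Type*} [Semiring B] [CommRing S] [IsDomain S]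
    [Fintype ι] (f : B →+* S) {x : S} (hx : x ≠ 0) (b : ι → S)
    (h0 : ∀ p : ι → B[X], ∑ m, (p m).eval₂ f x * b m = 0 → ∀ m, (p m).coeff 0 = 0)
    {p : ι → B[X]} (hp : ∑ m, (p m).eval₂ f x * b m = 0) : ∀ m, p m = 0 := by
  suffices h : ∀ n, ∀ p : ι → B[X], ∑ m, (p m).eval₂ f x * b m = 0 → ∀ m, (p m).coeff n = 0 from
    fun m => Polynomial.ext fun n => by simpa using h n p hp m
  intro n
  induction n with
  | zero => exact h0
  | succ n ih =>
    intro p hp m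
    rw [← coeff_divX]
    refine ih (fun m => (p m).divX) (mul_left_cancel₀ hx ?_) m
    rw [mul_zero, ← hp, Finset.mul_sum]
    refine Finset.sum_congr rfl fun m _ => ?_
    conv_rhs => rw [← divX_mul_X_add (p m), h0 p hp m, map_zero, add_zero, eval₂_mul, eval₂_X]
    ring

/-- Evaluation of a polynomial in two variables. -/
def evalTwo {F A : Type*} [CommRing F] [CommRing A] [Algebra F A] (x y : A) : F[X][X] →+* A :=
  eval₂RingHom (aeval x : F[X] →ₐ[F] A) y

theorem map_evalTwo {F A B : Type*} [CommRing F] [CommRing A] [CommRing B] [Algebra F A]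
    [Algebra F B] (f : A →ₐ[F] B) (x y : A) (p : F[X][X]) :
    f (evalTwo x y p) = evalTwo (f x) (f y) p := by
  have h : (f : A →+* B).comp ((aeval x : F[X] →ₐ[F] A) : F[X] →+* A) =
      ((aeval (f x) : F[X] →ₐ[F] B) : F[X] →+* B) :=
    ringHom_ext (by simp) (by simp)
  simp only [evalTwo, coe_eval₂RingHom]
  rw [← h]
  exact hom_eval₂ p _ (f : A →+* B) y

theorem evalTwo_injective {F A B : Type*} [CommRing F] [CommRing A] [IsDomain A] [CommRing B]
    [Algebra F A] [Algebra F B] (f : A →ₐ[F] B) {x y : A} (hy : y ≠ 0) (hfy : f y = 0)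
    (hx : Function.Injective (aeval (f x) : F[X] →ₐ[F] B)) :
    Function.Injective (evalTwo x y : F[X][X] →+* A) := by
  rw [injective_iff_map_eq_zero]
  intro p hp
  refine eq_zero_of_sum_eval₂_mul_eq_zero (ι := Unit) ((aeval x : F[X] →ₐ[F] A) : F[X] →+* A) hy
    (fun _ => 1) (fun p hp _ => ?_) (p := fun _ => p) (by simpa [evalTwo] using hp) ()
  have h1 : evalTwo x y (p ()) = 0 := by simpa [evalTwo] using hp
  have h2 := congrArg f h1
  rw [map_evalTwo, hfy, map_zero] at h2
  apply hx
  simpa [evalTwo, eval₂_at_zero] using h2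

end Polynomial

section Reduction

variable {F : Type} [Field F] [Fintype F]

local notation "𝔮" => Fintype.card F

/-- Reduction modulo `x₁`. -/
def reduceX : R2 F →ₐ[F] Polynomial (MvPolynomial (Fin 2) F) :=
  aeval ![0, Polynomial.X, Polynomial.C (X 0), Polynomial.C (X 1)]

variable (F) in
/-- The Dickson form in the two variables `y₁, y₂`. -/
def skewY (n : ℕ) : MvPolynomial (Fin 2) F := X 0 * X 1 ^ 𝔮 ^ n - X 1 * X 0 ^ 𝔮 ^ n

theorem skewY_ne_zero : skewY F 1 ≠ 0 := by
  intro h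
  have hq : 1 < 𝔮 := Fintype.one_lt_card
  have := congrArg (aeval (R := F) ![1, (Polynomial.X : Polynomial F)]) h
  simp only [skewY, map_sub, map_mul, map_pow, aeval_X, map_zero, Matrix.cons_val,
    one_mul, one_pow, mul_one, pow_one] at this
  have h2 := congrArg Polynomial.natDegree (sub_eq_zero.mp this)
  rw [Polynomial.natDegree_X_pow, Polynomial.natDegree_X] at h2
  omega

theorem reduceX_d22 : reduceX (d22 F 𝔮) = 0 := by
  simp [reduceX, d22]

theorem reduceX_d22s : reduceX (d22s F 𝔮) = Polynomial.C (skewY F 1) := by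
  simp [reduceX, d22s, skewY]

omit [Fintype F] in
theorem reduceX_u0 : reduceX (u0 F) = Polynomial.X * Polynomial.C (X 1) := by
  simp [reduceX, u0]

theorem reduceX_u1 : reduceX (u1 F 𝔮) = Polynomial.X ^ 𝔮 * Polynomial.C (X 1) := by
  simp [reduceX, u1]

theorem reduceX_u1s : reduceX (u1s F 𝔮) = Polynomial.X * Polynomial.C (X 1) ^ 𝔮 := by
  simp [reduceX, u1s]

/-- The generators of the module, indexed. -/
def gen (h : ℕ → R2 F) : GenIdx 𝔮 → R2 F
  | .inl (i, j) => u1s F 𝔮 ^ (i : ℕ) * u1 F 𝔮 ^ (j : ℕ)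
  | .inr (.inl (i, j, k)) => u1s F 𝔮 ^ (i : ℕ) * u1 F 𝔮 ^ (j : ℕ) * u0 F ^ (k + 1 : ℕ)
  | .inr (.inr (s, k)) => h (s + 1) * u0 F ^ (k : ℕ)

omit [Fintype F] in
theorem skew_mul_eq_div {A : Type*} [CommRing A] [IsDomain A] {x y c : A} {q : ℕ} (hq : 1 < q)
    (hx : x ≠ 0) (h : (y * x ^ q - x * y ^ q) * c = y * x ^ q ^ 2 - x * y ^ q ^ 2) :
    (y * x ^ (q - 1) - y ^ q) * c = y * x ^ (q ^ 2 - 1) - y ^ q ^ 2 := by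
  have hq2 : q < q ^ 2 := by nlinarith
  apply mul_left_cancel₀ hx
  have h1 : x ^ q = x ^ (q - 1) * x := by rw [← pow_succ, Nat.sub_add_cancel hq.le]
  have h2 : x ^ q ^ 2 = x ^ (q ^ 2 - 1) * x := by rw [← pow_succ, Nat.sub_add_cancel (by omega)]
  rw [h1, h2] at h
  linear_combination h

namespace DicksonData

variable {c21 c21s : R2 F} {h : ℕ → R2 F} (D : DicksonData c21 c21s h)
include D

theorem reduceX_c21 : reduceX c21 = Polynomial.X ^ (𝔮 ^ 2 - 𝔮) := by
  have hq : 1 < 𝔮 := Fintype.one_lt_card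
  have hq2 : 𝔮 < 𝔮 ^ 2 := by nlinarith
  have h2 := congrArg reduceX (skew_mul_eq_div hq (X_ne_zero (0 : Fin 4)) D.mul_c21)
  simp only [reduceX, map_mul, map_sub, map_pow, aeval_X, Matrix.cons_val] at h2
  rw [zero_pow (by omega), zero_pow (by omega)] at h2
  apply mul_left_cancel₀ (pow_ne_zero 𝔮 (Polynomial.X_ne_zero (R := MvPolynomial (Fin 2) F)))
  rw [← pow_add, Nat.add_sub_cancel' hq2.le, reduceX]
  linear_combination -h2

theorem skewY_mul_coeff : skewY F 1 * (reduceX c21s).coeff 0 = skewY F 2 := by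
  have := congrArg (fun p => (reduceX p).coeff 0) D.mul_c21s
  simp only [map_mul, reduceX_d22s, Polynomial.coeff_C_mul] at this
  rw [this]
  have h2 : reduceX (X 2 * X 3 ^ 𝔮 ^ 2 - X 3 * X 2 ^ 𝔮 ^ 2 : R2 F) =
      Polynomial.C (skewY F 2) := by simp [reduceX, skewY]
  rw [h2, Polynomial.coeff_C_zero]

theorem reduceX_c21s : reduceX c21s = Polynomial.C ((reduceX c21s).coeff 0) := by
  apply mul_left_cancel₀ (Polynomial.C_ne_zero.mpr (skewY_ne_zero (F := F)))
  rw [← Polynomial.C_mul, D.skewY_mul_coeff, ← reduceX_d22s, ← map_mul, D.mul_c21s]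
  simp [reduceX, skewY]

theorem reduceX_gen (m : GenIdx 𝔮) :
    reduceX (gen h m) * Polynomial.C (X 1 ^ (𝔮 - 1)) =
      Polynomial.X ^ xExp 𝔮 m * Polynomial.C (X 1 ^ yExp 𝔮 m * skewY F 1 ^ dExp 𝔮 m) := by
  have hq : 1 < 𝔮 := Fintype.one_lt_card
  rcases m with ⟨i, j⟩ | ⟨i, j, k⟩ | ⟨s, k⟩
  · simp only [gen, xExp, yExp, dExp, map_mul, map_pow, reduceX_u1, reduceX_u1s]
    ring
  · simp only [gen, xExp, yExp, dExp, map_mul, map_pow, reduceX_u0, reduceX_u1, reduceX_u1s]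
    ring
  · have h1 := congrArg reduceX (D.mul_h (s + 1) (by omega))
    simp only [map_add, map_mul, map_pow, reduceX_u0, reduceX_u1, reduceX_u1s, reduceX_d22,
      reduceX_d22s] at h1
    rw [zero_pow (by omega), mul_zero, add_zero] at h1
    apply mul_left_cancel₀ (a := Polynomial.X ^ 𝔮 * Polynomial.C (X 1))
      (mul_ne_zero (pow_ne_zero _ Polynomial.X_ne_zero) (Polynomial.C_ne_zero.mpr (X_ne_zero _)))
    simp only [gen, xExp, yExp, dExp, map_mul, map_pow, reduceX_u0]
    have h2 : Polynomial.C (X (R := F) (1 : Fin 2)) ^ 𝔮 =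
        Polynomial.C (X 1) ^ (𝔮 - 1) * Polynomial.C (X 1) := by
      rw [← pow_succ, Nat.sub_add_cancel hq.le]
    rw [mul_pow, h2] at h1
    rw [show Polynomial.X (R := MvPolynomial (Fin 2) F) ^ (𝔮 * (s + 1) + k) =
      (Polynomial.X ^ 𝔮) ^ (s + 1 : ℕ) * Polynomial.X ^ (k : ℕ) by rw [← pow_mul, ← pow_add]]
    linear_combination (Polynomial.X * Polynomial.C (X 1)) ^ (k : ℕ) * h1

end DicksonData

end Reduction

section Independence

variable {F : Type} [Field F] [Fintype F]

local notation "𝔮" => Fintype.card F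

namespace DicksonData

variable {c21 c21s : R2 F} {h : ℕ → R2 F} (D : DicksonData c21 c21s h)
include D

theorem evalTwo_reduceX_injective :
    Function.Injective (Polynomial.evalTwo ((reduceX c21s).coeff 0) (skewY F 1) :
      Polynomial (Polynomial F) →+* MvPolynomial (Fin 2) F) := by
  have hq : 1 < 𝔮 := Fintype.one_lt_card
  have hq2 : 𝔮 < 𝔮 ^ 2 := by nlinarith
  refine Polynomial.evalTwo_injective (aeval ![0, (Polynomial.X : Polynomial F)])
    skewY_ne_zero (by simp [skewY]) ?_
  have h1 : aeval ![0, (Polynomial.X : Polynomial F)] ((reduceX c21s).coeff 0) =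
      Polynomial.X ^ (𝔮 ^ 2 - 𝔮) := by
    have h2 := congrArg (aeval ![0, (Polynomial.X : Polynomial F)])
      (skew_mul_eq_div (c := (reduceX c21s).coeff 0) hq (X_ne_zero (0 : Fin 2))
        (y := X 1) (by
          have := D.skewY_mul_coeff
          simp only [skewY, pow_one] at this
          linear_combination -this))
    simp only [map_mul, map_sub, map_pow, aeval_X, Matrix.cons_val] at h2
    rw [zero_pow (by omega), zero_pow (by omega)] at h2
    apply mul_left_cancel₀ (pow_ne_zero 𝔮 (Polynomial.X_ne_zero (R := F)))
    rw [← pow_add, Nat.add_sub_cancel' hq2.le]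
    linear_combination -h2
  rw [h1]
  have := Polynomial.expand_injective (R := F) (show 0 < 𝔮 ^ 2 - 𝔮 by omega)
  intro p p' hp
  apply this
  simpa only [Polynomial.expand_eq_comp_X_pow, Polynomial.comp, Polynomial.aeval_def,
    Polynomial.algebraMap_eq] using hp

theorem exists_endomorphism {v : F × F} (hv : v ≠ 0) :
    ∃ σ : MvPolynomial (Fin 2) F →+* MvPolynomial (Fin 2) F,
      σ (X 1) = v.1 • X 0 + v.2 • X 1 ∧
      ∀ x ∈ (Polynomial.evalTwo ((reduceX c21s).coeff 0) (skewY F 1) :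
        Polynomial (Polynomial F) →+* MvPolynomial (Fin 2) F).range, σ x = x := by
  obtain ⟨a, b, hab⟩ : ∃ a b : F, a * v.2 - -b * -v.1 = 1 := by
    by_cases h1 : v.1 = 0
    · have h2 : v.2 ≠ 0 := fun h2 => hv (Prod.ext h1 h2)
      exact ⟨v.2⁻¹, 0, by simp [h2]⟩
    · exact ⟨0, -v.1⁻¹, by simp [h1]⟩
  let σ : MvPolynomial (Fin 2) F →ₐ[F] MvPolynomial (Fin 2) F :=
    aeval ![a • X 0 + b • X 1, v.1 • X 0 + v.2 • X 1]
  have hσ : ∀ n, σ (skewY F n) = skewY F n := by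
    intro n
    have := Polynomial.skew_pow_eq hab n (X 1 : MvPolynomial (Fin 2) F) (X 0)
    simp only [skewY, map_sub, map_mul, map_pow, σ, aeval_X, Matrix.cons_val]
    rw [← this, neg_smul, neg_smul, sub_neg_eq_add, sub_neg_eq_add, add_comm (v.1 • _)]
  have hc : σ ((reduceX c21s).coeff 0) = (reduceX c21s).coeff 0 := by
    apply mul_left_cancel₀ (skewY_ne_zero (F := F))
    rw [D.skewY_mul_coeff, ← hσ 2, ← D.skewY_mul_coeff, map_mul, hσ]
  refine ⟨σ, by simp [σ], ?_⟩
  rintro _ ⟨p, rfl⟩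
  have := Polynomial.map_evalTwo σ ((reduceX c21s).coeff 0) (skewY F 1) p
  rwa [hc, hσ] at this

end DicksonData

/-- Evaluation of polynomials in four variables at `c₂₁*`, `d₂₂*`, `c₂₁`, `d₂₂`. -/
def evalGen (c21 c21s : R2 F) :
    Polynomial (Polynomial (Polynomial (Polynomial F))) →+* R2 F :=
  Polynomial.eval₂RingHom
    (Polynomial.eval₂RingHom (Polynomial.evalTwo c21s (d22s F 𝔮)) c21) (d22 F 𝔮)

namespace DicksonData

variable {c21 c21s : R2 F} {h : ℕ → R2 F} (D : DicksonData c21 c21s h)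
include D

theorem reduceX_evalGen (p : Polynomial (Polynomial (Polynomial (Polynomial F)))) :
    reduceX (evalGen c21 c21s p) = Polynomial.expand _ (𝔮 ^ 2 - 𝔮)
      ((p.coeff 0).map (Polynomial.evalTwo ((reduceX c21s).coeff 0) (skewY F 1))) := by
  rw [evalGen, Polynomial.coe_eval₂RingHom, ← AlgHom.coe_toRingHom, Polynomial.hom_eval₂,
    AlgHom.coe_toRingHom, reduceX_d22, Polynomial.eval₂_at_zero, RingHom.comp_apply,
    Polynomial.coe_eval₂RingHom, Polynomial.hom_eval₂, AlgHom.coe_toRingHom, D.reduceX_c21,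
    Polynomial.expand_eq_comp_X_pow, Polynomial.comp, Polynomial.eval₂_map]
  congr 1
  refine RingHom.ext fun r => ?_
  rw [RingHom.comp_apply, RingHom.comp_apply, AlgHom.coe_toRingHom, Polynomial.map_evalTwo,
    D.reduceX_c21s, reduceX_d22s, Polynomial.coeff_C_zero]
  exact (Polynomial.map_evalTwo (Polynomial.CAlgHom (R := F) (A := MvPolynomial (Fin 2) F)) _ _ r).symm


end DicksonData
end Independence

section Independence

variable {F : Type} [Field F] [Fintype F]

local notation "𝔮" => Fintype.card F

namespace DicksonData

variable {c21 c21s : R2 F} {h : ℕ → R2 F} (D : DicksonData c21 c21s h)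
include D

theorem coeff_zero_eq_zero {p : GenIdx 𝔮 → Polynomial (Polynomial (Polynomial (Polynomial F)))}
    (hp : reduceX (∑ m, evalGen c21 c21s (p m) * gen h m) = 0) (m : GenIdx 𝔮) :
    (p m).coeff 0 = 0 := by
  classical
  have hq : 2 ≤ 𝔮 := Fintype.one_lt_card
  have hq2 : 𝔮 < 𝔮 ^ 2 := by nlinarith
  have hcard : Fintype.card {v : F × F // v ≠ 0} = 𝔮 ^ 2 - 1 := by
    rw [Fintype.card_subtype_compl, Fintype.card_prod, Fintype.card_subtype_eq, sq]
  have h1 : ∑ m, Polynomial.expand _ (𝔮 ^ 2 - 𝔮)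
      (((p m).coeff 0).map (Polynomial.evalTwo ((reduceX c21s).coeff 0) (skewY F 1))) *
      (Polynomial.X ^ xExp 𝔮 m * Polynomial.C (X 1 ^ yExp 𝔮 m * skewY F 1 ^ dExp 𝔮 m)) = 0 := by
    rw [← zero_mul (Polynomial.C (X 1 ^ (𝔮 - 1))), ← hp, map_sum, Finset.sum_mul]
    exact Finset.sum_congr rfl fun m _ => by
      rw [map_mul reduceX, D.reduceX_evalGen, mul_assoc, D.reduceX_gen]
  have h2 := Polynomial.eq_zero_of_sum_expand_mul_eq_zero
    (Λ := {v : F × F // v ≠ 0})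
    (Polynomial.evalTwo ((reduceX c21s).coeff 0) (skewY F 1) :
        Polynomial (Polynomial F) →+* MvPolynomial (Fin 2) F).range
    (z := X 1) (z' := fun v : {v : F × F // v ≠ 0} => v.1.1 • X 0 + v.1.2 • X 1)
    (by
      intro v v' hvv
      apply Subtype.ext
      have h3 := congrArg (aeval (R := F) ![(1 : F), 0]) hvv
      have h4 := congrArg (aeval (R := F) ![(0 : F), 1]) hvv
      exact Prod.ext (by simpa using h3) (by simpa using h4))
    (by
      intro v hvv
      apply v.2
      have h3 := congrArg (aeval (R := F) ![(1 : F), 0]) hvv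
      have h4 := congrArg (aeval (R := F) ![(0 : F), 1]) hvv
      exact Prod.ext (by simpa using h3) (by simpa using h4))
    (fun v => D.exists_endomorphism v.2)
    (show 0 < 𝔮 ^ 2 - 𝔮 by omega) (d := skewY F 1) (a := xExp 𝔮) (b := yExp 𝔮) (e := dExp 𝔮)
    ⟨Polynomial.X, by simp [Polynomial.evalTwo]⟩ skewY_ne_zero
    (fun m m' hm => (yExp_of_modEq hq m m' hm).1)
    (fun m m' hm => by rw [hcard]; exact (yExp_of_modEq hq m m' hm).2)
    (g := fun m => ((p m).coeff 0).map (Polynomial.evalTwo ((reduceX c21s).coeff 0) (skewY F 1)))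
    (fun m n => by rw [Polynomial.coeff_map]; exact ⟨_, rfl⟩) h1 m
  exact Polynomial.map_injective _ D.evalTwo_reduceX_injective (by rw [h2, Polynomial.map_zero])

theorem eq_zero_of_sum_evalGen_mul_eq_zero
    {p : GenIdx 𝔮 → Polynomial (Polynomial (Polynomial (Polynomial F)))}
    (hp : ∑ m, evalGen c21 c21s (p m) * gen h m = 0) (m : GenIdx 𝔮) : p m = 0 := by
  simp only [evalGen, Polynomial.coe_eval₂RingHom] at hp
  have h0 := Polynomial.eq_zero_of_sum_eval₂_mul_eq_zero (p := p)
    (Polynomial.eval₂RingHom (Polynomial.evalTwo c21s (d22s F 𝔮)) c21)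
    (d22_ne_zero (F := F) (q := 𝔮) Fintype.one_lt_card) (gen h)
  refine h0 (fun p hp => ?_) hp m
  refine D.coeff_zero_eq_zero (p := p) ?_
  simp only [evalGen, Polynomial.coe_eval₂RingHom, hp, map_zero]

theorem exists_of_d22_mul_eq {g : R2 F}
    {p : GenIdx 𝔮 → Polynomial (Polynomial (Polynomial (Polynomial F)))}
    (hp : d22 F 𝔮 * g = ∑ m, evalGen c21 c21s (p m) * gen h m) :
    ∃ p' : GenIdx 𝔮 → Polynomial (Polynomial (Polynomial (Polynomial F))),
      g = ∑ m, evalGen c21 c21s (p' m) * gen h m := by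
  refine ⟨fun m => (p m).divX, mul_left_cancel₀ (d22_ne_zero (F := F) (q := 𝔮) Fintype.one_lt_card) ?_⟩
  rw [hp, Finset.mul_sum]
  refine Finset.sum_congr rfl fun m _ => ?_
  have h0 := D.coeff_zero_eq_zero (p := p) (by rw [← hp, map_mul, reduceX_d22, zero_mul]) m
  conv_lhs => rw [← Polynomial.divX_mul_X_add (p m), h0, map_zero, add_zero, map_mul]
  simp only [evalGen, Polynomial.coe_eval₂RingHom, Polynomial.eval₂_X]
  ring

end DicksonData

end Independence

section Spanning

variable {F : Type} [Field F] [Fintype F]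

local notation "𝔮" => Fintype.card F

/-- Substituting `u₀, u₁` for the coefficient variables and `x₁, x₂` for the polynomial
variables. -/
def substU : Polynomial (Polynomial (MvPolynomial (Fin 2) F)) →+* R2 F :=
  Polynomial.eval₂RingHom
    (Polynomial.eval₂RingHom (aeval ![u0 F, u1 F 𝔮] : MvPolynomial (Fin 2) F →ₐ[F] R2 F) (X 0))
    (X 1)

@[simp] theorem substU_C_C (e : MvPolynomial (Fin 2) F) :
    substU (Polynomial.C (Polynomial.C e)) = aeval ![u0 F, u1 F 𝔮] e := by
  simp [substU]

@[simp] theorem substU_C_X : substU (F := F) (Polynomial.C Polynomial.X) = X 0 := by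
  simp [substU]

@[simp] theorem substU_X : substU (F := F) Polynomial.X = X 1 := by
  simp [substU]

theorem substU_sub (p r : Polynomial (Polynomial (MvPolynomial (Fin 2) F))) :
    substU (p - r) = substU p - substU r :=
  RingHom.map_sub substU p r

variable (F) in
/-- The Dickson form in the polynomial variables. -/
def skewX : Polynomial (Polynomial (MvPolynomial (Fin 2) F)) :=
  Polynomial.X * Polynomial.C Polynomial.X ^ 𝔮 - Polynomial.C Polynomial.X * Polynomial.X ^ 𝔮

theorem substU_skewX : substU (skewX F) = d22 F 𝔮 := by
  rw [skewX, substU_sub, map_mul, map_mul, map_pow, map_pow, substU_C_X, substU_X, d22]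

theorem skewX_ne_zero : skewX F ≠ 0 := by
  intro h
  have := congrArg substU h
  rw [substU_skewX, map_zero] at this
  exact d22_ne_zero Fintype.one_lt_card this

theorem substU_injective : Function.Injective (substU (F := F)) := by
  let P := Polynomial (Polynomial (MvPolynomial (Fin 2) F))
  let L := FractionRing P
  let i : P →ₐ[F] L := IsScalarTower.toAlgHom F P L
  have hi : Function.Injective i := IsFractionRing.injective P L
  have hδ : i (skewX F) ≠ 0 := by
    rw [← map_zero i]; exact hi.ne skewX_ne_zero
  let x₁ : L := i (Polynomial.C Polynomial.X)
  let x₂ : L := i Polynomial.X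
  let v₀ : L := i (Polynomial.C (Polynomial.C (X 0)))
  let v₁ : L := i (Polynomial.C (Polynomial.C (X 1)))
  have hδ' : i (skewX F) = x₂ * x₁ ^ 𝔮 - x₁ * x₂ ^ 𝔮 := by
    exact (map_sub (i : P →+* L) _ _).trans (by simp [x₁, x₂])
  rw [hδ'] at hδ
  let θ : R2 F →ₐ[F] L := aeval ![x₁, x₂, (v₁ * x₂ - v₀ * x₂ ^ 𝔮) / (x₂ * x₁ ^ 𝔮 - x₁ * x₂ ^ 𝔮),
    (v₀ * x₁ ^ 𝔮 - v₁ * x₁) / (x₂ * x₁ ^ 𝔮 - x₁ * x₂ ^ 𝔮)]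
  have hu0 : θ (u0 F) = v₀ := by
    simp only [θ, u0, map_add, map_mul, aeval_X, Matrix.cons_val]
    rw [mul_div_assoc', mul_div_assoc', ← add_div, div_eq_iff hδ]
    ring
  have hu1 : θ (u1 F 𝔮) = v₁ := by
    simp only [θ, u1, map_add, map_mul, map_pow, aeval_X, Matrix.cons_val]
    rw [mul_div_assoc', mul_div_assoc', ← add_div, div_eq_iff hδ]
    ring
  have hθ : (θ : R2 F →+* L).comp substU = (i : P →+* L) := by
    refine Polynomial.ringHom_ext' (Polynomial.ringHom_ext' (MvPolynomial.ringHom_ext ?_ ?_) ?_) ?_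
    · intro a
      rw [RingHom.comp_apply, RingHom.comp_apply, RingHom.comp_apply, RingHom.comp_apply,
        RingHom.comp_apply, substU_C_C, aeval_C]
      exact (θ.commutes a).trans (i.commutes a).symm
    · intro j
      fin_cases j
      · simpa using hu0
      · simpa using hu1
    · simp [θ, x₁]
    · simp [θ, x₂]
  refine Function.Injective.of_comp (f := θ) ?_
  intro a b hab
  apply hi
  have h1 := RingHom.congr_fun hθ a
  have h2 := RingHom.congr_fun hθ b
  exact h1.symm.trans (hab.trans h2)

theorem act_substU {A : GL (Fin 2) F} (hA : A ∈ SL2 F)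
    (p : Polynomial (Polynomial (MvPolynomial (Fin 2) F))) :
    act A (substU p) = substU (Polynomial.polyAct (MvPolynomial (Fin 2) F)
      (A.val 0 0) (A.val 0 1) (A.val 1 0) (A.val 1 1) p) := by
  have hsmul : ∀ (a : F) (p : Polynomial (Polynomial (MvPolynomial (Fin 2) F))),
      substU (a • p) = a • substU p := by
    intro a p
    have : a • p = Polynomial.C (Polynomial.C (C a)) * p := by
      rw [Algebra.smul_def]
      rfl
    rw [this, map_mul, substU_C_C, aeval_C, Algebra.smul_def]
  have h : (act A : R2 F →+* R2 F).comp substU = substU.comp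
      (Polynomial.polyAct (MvPolynomial (Fin 2) F)
      (A.val 0 0) (A.val 0 1) (A.val 1 0) (A.val 1 1) : _ →+* _) := by
    obtain ⟨h0, h1, -, -⟩ := act_X_of_mem_SL2 hA
    refine Polynomial.ringHom_ext' (Polynomial.ringHom_ext' (MvPolynomial.ringHom_ext ?_ ?_) ?_) ?_
    · intro a
      simp
    · intro j
      fin_cases j
      · simpa using act_u0 hA
      · simpa using act_u1 hA
    · rw [RingHom.comp_apply, RingHom.comp_apply, RingHom.comp_apply, RingHom.comp_apply,
        substU_C_X]
      refine h0.trans ?_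
      erw [Polynomial.polyAct_C_X]
      rw [substU_sub, hsmul, hsmul, substU_C_X, substU_X]
    · rw [RingHom.comp_apply, RingHom.comp_apply, substU_X]
      refine h1.trans ?_
      erw [Polynomial.polyAct_X]
      rw [substU_sub, hsmul, hsmul, substU_C_X, substU_X]
  exact RingHom.congr_fun h p

theorem exists_d22_pow_mul_eq_substU (f : R2 F) :
    ∃ n p, d22 F 𝔮 ^ n * f = substU p := by
  induction f using MvPolynomial.induction_on with
  | C a => exact ⟨0, Polynomial.C (Polynomial.C (C a)), by simp [algebraMap_eq]⟩
  | add f g hf hg =>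
    obtain ⟨n, p, hp⟩ := hf
    obtain ⟨m, r, hr⟩ := hg
    refine ⟨n + m, skewX F ^ m * p + skewX F ^ n * r, ?_⟩
    simp only [map_add, map_mul, map_pow, substU_skewX, ← hp, ← hr]
    ring
  | mul_X f i hf =>
    obtain ⟨n, p, hp⟩ := hf
    have h : ∃ p, d22 F 𝔮 * X i = substU p := by
      fin_cases i
      · exact ⟨skewX F * Polynomial.C Polynomial.X, by simp [substU_skewX]⟩
      · exact ⟨skewX F * Polynomial.X, by simp [substU_skewX]⟩
      · refine ⟨Polynomial.C (Polynomial.C (X 1)) * Polynomial.X -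
          Polynomial.C (Polynomial.C (X 0)) * Polynomial.X ^ 𝔮, ?_⟩
        rw [substU_sub, map_mul, map_mul, map_pow, substU_C_C, substU_C_C, substU_X]
        simp [d22, u0, u1]
        ring
      · refine ⟨Polynomial.C (Polynomial.C (X 0)) * Polynomial.C Polynomial.X ^ 𝔮 -
          Polynomial.C (Polynomial.C (X 1)) * Polynomial.C Polynomial.X, ?_⟩
        rw [substU_sub, map_mul, map_mul, map_pow, substU_C_C, substU_C_C, substU_C_X]
        simp [d22, u0, u1]
        ring
    obtain ⟨r, hr⟩ := h
    refine ⟨n + 1, p * r, ?_⟩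
    rw [map_mul, ← hp, ← hr]
    ring

end Spanning

namespace Polynomial

/-- Evaluation of a polynomial in four variables. -/
def evalFour {F A : Type*} [CommRing F] [CommRing A] [Algebra F A] (a b c d : A) :
    F[X][X][X][X] →+* A :=
  eval₂RingHom (eval₂RingHom (evalTwo a b) c) d

theorem mem_adjoin_iff_exists_evalFour {F A : Type*} [CommRing F] [CommRing A] [Algebra F A]
    {a b c d t : A} :
    t ∈ Algebra.adjoin F ({d, c, b, a} : Set A) ↔ ∃ p, evalFour (F := F) a b c d p = t := by
  constructor
  · intro ht
    induction ht using Algebra.adjoin_induction with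
    | mem x hx =>
      rcases hx with rfl | rfl | rfl | rfl
      · exact ⟨X, by simp [evalFour]⟩
      · exact ⟨C X, by simp [evalFour]⟩
      · exact ⟨C (C X), by simp [evalFour, evalTwo]⟩
      · exact ⟨C (C (C X)), by simp [evalFour, evalTwo]⟩
    | algebraMap r => exact ⟨C (C (C (C r))), by simp [evalFour, evalTwo]⟩
    | add x y _ _ hx hy =>
      obtain ⟨p, rfl⟩ := hx
      obtain ⟨r, rfl⟩ := hy
      exact ⟨p + r, map_add _ _ _⟩
    | mul x y _ _ hx hy =>
      obtain ⟨p, rfl⟩ := hx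
      obtain ⟨r, rfl⟩ := hy
      exact ⟨p * r, map_mul _ _ _⟩
  · rintro ⟨p, rfl⟩
    have hd := Algebra.subset_adjoin (R := F) (show d ∈ ({d, c, b, a} : Set A) by simp)
    have hc := Algebra.subset_adjoin (R := F) (show c ∈ ({d, c, b, a} : Set A) by simp)
    have hb := Algebra.subset_adjoin (R := F) (show b ∈ ({d, c, b, a} : Set A) by simp)
    have ha := Algebra.subset_adjoin (R := F) (show a ∈ ({d, c, b, a} : Set A) by simp)
    rw [evalFour, coe_eval₂RingHom, eval₂_eq_sum_range]
    refine sum_mem fun i _ => mul_mem ?_ (pow_mem hd i)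
    rw [coe_eval₂RingHom, eval₂_eq_sum_range]
    refine sum_mem fun i _ => mul_mem ?_ (pow_mem hc i)
    rw [evalTwo, coe_eval₂RingHom, eval₂_eq_sum_range]
    refine sum_mem fun i _ => mul_mem ?_ (pow_mem hb i)
    rw [RingHom.coe_coe, aeval_eq_sum_range]
    exact sum_mem fun i _ => Subalgebra.smul_mem _ (pow_mem ha i) _

end Polynomial

section Spanning

variable {F : Type} [Field F] [Fintype F]

local notation "𝔮" => Fintype.card F

/-- The span of the generators over the algebra of `d₂₂`, `c₂₁`, `d₂₂*`, `c₂₁*`. -/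
def genSpan (c21 c21s : R2 F) (h : ℕ → R2 F) :
    Submodule (Algebra.adjoin F {d22 F 𝔮, c21, d22s F 𝔮, c21s}) (R2 F) :=
  Submodule.span _ (Set.range (gen h))

theorem mem_genSpan_iff {c21 c21s : R2 F} {h : ℕ → R2 F} {f : R2 F} :
    f ∈ genSpan c21 c21s h ↔ ∃ p : GenIdx 𝔮 → Polynomial (Polynomial (Polynomial (Polynomial F))),
      f = ∑ m, evalGen c21 c21s (p m) * gen h m := by
  rw [genSpan, Submodule.mem_span_range_iff_exists_fun]
  constructor
  · rintro ⟨t, rfl⟩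
    choose p hp using fun m => Polynomial.mem_adjoin_iff_exists_evalFour.1 (t m).2
    refine ⟨p, Finset.sum_congr rfl fun m _ => ?_⟩
    rw [Subalgebra.smul_def, ← hp m, smul_eq_mul]
    rfl
  · rintro ⟨p, rfl⟩
    exact ⟨fun m => ⟨_, Polynomial.mem_adjoin_iff_exists_evalFour.2 ⟨p m, rfl⟩⟩, rfl⟩

theorem mul_mem_genSpan {c21 c21s t : R2 F} {h : ℕ → R2 F}
    (ht : t ∈ ({d22 F 𝔮, c21, d22s F 𝔮, c21s} : Set (R2 F))) :
    ∀ m ∈ genSpan c21 c21s h, t * m ∈ genSpan c21 c21s h :=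
  fun _ hm => Submodule.smul_mem _ (⟨t, Algebra.subset_adjoin ht⟩ :
    Algebra.adjoin F {d22 F 𝔮, c21, d22s F 𝔮, c21s}) hm

theorem gen_mem_genSpan {c21 c21s : R2 F} {h : ℕ → R2 F} (m : GenIdx 𝔮) :
    gen h m ∈ genSpan c21 c21s h :=
  Submodule.subset_span ⟨m, rfl⟩

omit [Fintype F] in
theorem map_skew_mul_eq {A B : Type*} [CommRing A] [CommRing B] (f : A →+* B) {x y c : A}
    {m n : ℕ} (h : (y * x ^ m - x * y ^ m) * c = y * x ^ n - x * y ^ n) :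
    (f y * f x ^ m - f x * f y ^ m) * f c = f y * f x ^ n - f x * f y ^ n := by
  simpa using congrArg f h

theorem exists_substU_eq {c21 : R2 F}
    (hc21 : d22 F 𝔮 * c21 = X 1 * X 0 ^ 𝔮 ^ 2 - X 0 * X 1 ^ 𝔮 ^ 2) :
    ∃ c, substU c = c21 ∧
      (Polynomial.X * Polynomial.C Polynomial.X ^ 𝔮 - Polynomial.C Polynomial.X * Polynomial.X ^ 𝔮)
        * c = Polynomial.X * Polynomial.C Polynomial.X ^ 𝔮 ^ 2 -
          Polynomial.C Polynomial.X * Polynomial.X ^ 𝔮 ^ 2 := by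
  let σ : R2 F →+* Polynomial (Polynomial (MvPolynomial (Fin 2) F)) :=
    eval₂Hom (algebraMap F _) (![Polynomial.C Polynomial.X, Polynomial.X, 0, 0] :
      Fin 4 → Polynomial (Polynomial (MvPolynomial (Fin 2) F)))
  have e0 : σ (X 0) = Polynomial.C Polynomial.X := by simp [σ]
  have e1 : σ (X 1) = Polynomial.X := by simp [σ]
  have h := map_skew_mul_eq (A := R2 F)
    (B := Polynomial (Polynomial (MvPolynomial (Fin 2) F))) σ hc21
  rw [e0, e1] at h
  refine ⟨σ c21, ?_, h⟩
  have h' := congrArg substU h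
  rw [map_mul, substU_sub, substU_sub, map_mul, map_mul, map_mul, map_mul, map_pow, map_pow,
    map_pow, map_pow, substU_C_X, substU_X, ← hc21, d22] at h'
  exact mul_left_cancel₀ (d22_ne_zero (F := F) (q := 𝔮) Fintype.one_lt_card) h'

namespace DicksonData

variable {c21 c21s : R2 F} {h : ℕ → R2 F} (D : DicksonData c21 c21s h)
include D

theorem u0_u1_mul_mem_genSpan :
    (∀ m ∈ genSpan c21 c21s h, u0 F * m ∈ genSpan c21 c21s h) ∧
      ∀ m ∈ genSpan c21 c21s h, u1 F 𝔮 * m ∈ genSpan c21 c21s h := by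
  have hq : 2 ≤ 𝔮 := Fintype.one_lt_card
  refine mul_mem_of_relations hq u1_mul_u1s D.h_zero D.h_last D.mul_h
    (fun s hs => (D.rel hs).1) (fun s hs => (D.rel hs).2) (genSpan c21 c21s h).toAddSubgroup
    (mul_mem_genSpan (by simp)) (mul_mem_genSpan (by simp)) (mul_mem_genSpan (by simp))
    (mul_mem_genSpan (by simp)) (fun i j hi hj => ?_) (fun i j k hi hj hk hk' => ?_)
    (fun s k hs hs' hk => ?_) (fun x h1 h2 h3 m hm => ?_)
  · exact gen_mem_genSpan (.inl (⟨i, by omega⟩, ⟨j, by omega⟩))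
  · obtain ⟨k, rfl⟩ := Nat.exists_eq_add_of_le' hk
    exact gen_mem_genSpan (.inr (.inl (⟨i, by omega⟩, ⟨j, by omega⟩, ⟨k, by omega⟩)))
  · obtain ⟨s, rfl⟩ := Nat.exists_eq_add_of_le' hs
    exact gen_mem_genSpan (.inr (.inr (⟨s, by omega⟩, ⟨k, by omega⟩)))
  · change m ∈ genSpan c21 c21s h at hm
    change x * m ∈ genSpan c21 c21s h
    rw [genSpan] at hm
    induction hm using Submodule.span_induction with
    | mem m hm =>
      obtain ⟨m, rfl⟩ := hm
      rcases m with ⟨i, j⟩ | ⟨i, j, k⟩ | ⟨s, k⟩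
      · exact h1 i j (by omega) (by omega)
      · exact h2 i j (k + 1) (by omega) (by omega) (by omega) (by omega)
      · exact h3 (s + 1) k (by omega) (by omega) (by omega)
    | zero => rw [mul_zero]; exact zero_mem _
    | add m m' _ _ hm hm' => rw [mul_add]; exact add_mem hm hm'
    | smul t m _ hm => rw [mul_smul_comm]; exact Submodule.smul_mem _ t hm

theorem substU_mul_mem_genSpan {c p : Polynomial (Polynomial (MvPolynomial (Fin 2) F))}
    (hc : substU c = c21)
    (hp : p ∈ Algebra.adjoin (MvPolynomial (Fin 2) F) {skewX F, c}) :
    ∀ m ∈ genSpan c21 c21s h, substU p * m ∈ genSpan c21 c21s h := by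
  induction hp using Algebra.adjoin_induction with
  | mem x hx =>
    rcases hx with rfl | rfl
    · rw [substU_skewX]; exact mul_mem_genSpan (by simp)
    · rw [hc]; exact mul_mem_genSpan (by simp)
  | algebraMap e =>
    change ∀ m ∈ genSpan c21 c21s h,
      substU (Polynomial.C (Polynomial.C e)) * m ∈ genSpan c21 c21s h
    rw [substU_C_C]
    induction e using MvPolynomial.induction_on with
    | C a =>
      intro m hm
      rw [aeval_C, ← Algebra.smul_def]
      exact Submodule.smul_of_tower_mem _ a hm
    | add e e' he he' =>
      intro m hm
      rw [map_add, add_mul]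
      exact add_mem (he m hm) (he' m hm)
    | mul_X e i he =>
      intro m hm
      rw [map_mul, mul_assoc, aeval_X]
      refine he _ ?_
      fin_cases i
      · exact D.u0_u1_mul_mem_genSpan.1 m hm
      · exact D.u0_u1_mul_mem_genSpan.2 m hm
  | add x y _ _ hx hy =>
    intro m hm
    rw [map_add, add_mul]
    exact add_mem (hx m hm) (hy m hm)
  | mul x y _ _ hx hy =>
    intro m hm
    rw [map_mul, mul_assoc]
    exact hx _ (hy m hm)

theorem mem_genSpan_of_mem_invariantRing {f : R2 F} (hf : f ∈ invariantRing (SL2 F)) :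
    f ∈ genSpan c21 c21s h := by
  obtain ⟨n, p, hp⟩ := exists_d22_pow_mul_eq_substU f
  obtain ⟨c, hc, hc'⟩ := exists_substU_eq D.mul_c21
  have hinv : ∀ a b c d : F, a * d - b * c = 1 →
      Polynomial.polyAct (MvPolynomial (Fin 2) F) a b c d p = p := by
    intro a b c d hdet
    have hdet' : (!![a, b; c, d]).det = 1 := by rw [Matrix.det_fin_two_of, hdet]
    let A : GL (Fin 2) F := Matrix.GeneralLinearGroup.mkOfDetNeZero !![a, b; c, d]
      (by rw [hdet']; exact one_ne_zero)
    have hA : A ∈ SL2 F := hdet'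
    apply substU_injective
    have := act_substU hA p
    rw [← hp, map_mul, map_pow, act_d22 hA, hf A hA, hp] at this
    exact this.symm
  have hmem := Polynomial.mem_adjoin_of_polyAct_eq hc' hinv
  have hone : (1 : R2 F) ∈ genSpan c21 c21s h := by
    have := gen_mem_genSpan (c21 := c21) (c21s := c21s) (h := h)
      (.inl (⟨0, Fintype.card_pos⟩, ⟨0, Fintype.card_pos⟩))
    simpa [gen] using this
  have key := D.substU_mul_mem_genSpan hc hmem 1 hone
  rw [mul_one, ← hp] at key
  clear hp hinv hmem
  induction n with
  | zero => simpa using key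
  | succ n ih =>
    apply ih
    rw [pow_succ', mul_assoc, mem_genSpan_iff] at key
    obtain ⟨p, hp⟩ := key
    exact mem_genSpan_iff.2 (D.exists_of_d22_mul_eq hp)

end DicksonData

end Spanning

namespace Polynomial

theorem eq_zero_of_sum_expand_mul_X_pow_eq_zero {R : Type*} [CommSemiring R] {n : ℕ}
    {g : Fin n → R[X]} (h : ∑ b, expand R n (g b) * X ^ (b : ℕ) = 0) (b : Fin n) : g b = 0 := by
  have hn : 0 < n := b.pos
  ext k
  have hk := congrArg (coeff · (k * n + b)) h
  simp only [finsetSum_coeff, coeff_zero] at hk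
  rw [Finset.sum_eq_single b, coeff_mul_X_pow, coeff_expand_mul hn] at hk
  · simpa using hk
  · intro b' _ hb
    rw [coeff_mul_X_pow']
    split_ifs with hle
    · rw [coeff_expand hn, if_neg]
      rintro ⟨c, hc⟩
      apply hb
      have : k * n + b = n * c + b' := by omega
      have := congrArg (· % n) this
      simp only [Nat.mul_add_mod, Nat.mul_comm k n, Nat.mod_eq_of_lt b.2, Nat.mod_eq_of_lt b'.2]
        at this
      exact Fin.ext this.symm
    · rfl
  · simp

/-- Raising the second and fourth of four polynomial variables to the `n`-th power. -/
def expandFour (F : Type*) [CommRing F] (n : ℕ) : F[X][X][X][X] →+* F[X][X][X][X] :=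
  (expand F[X][X][X] n : F[X][X][X][X] →+* F[X][X][X][X]).comp
    (mapRingHom (mapRingHom (expand F[X] n : F[X][X] →+* F[X][X])))

theorem evalFour_expandFour {F A : Type*} [CommRing F] [CommRing A] [Algebra F A] {n : ℕ}
    (a b c d : A) (p : F[X][X][X][X]) :
    evalFour a b c d (expandFour F n p) = evalFour a (b ^ n) c (d ^ n) p := by
  have h : (evalFour a b c d).comp (expandFour F n) = evalFour a (b ^ n) c (d ^ n) := by
    refine ringHom_ext' (ringHom_ext' (ringHom_ext' (ringHom_ext' (RingHom.ext ?_) ?_) ?_) ?_) ?_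
    · simp [evalFour, expandFour, evalTwo]
    · simp [evalFour, expandFour, evalTwo]
    · simp [evalFour, expandFour, evalTwo, eval₂_pow]
    · simp [evalFour, expandFour]
    · simp [evalFour, expandFour]
  exact RingHom.congr_fun h p

theorem eq_zero_of_sum_expandFour_eq_zero {F : Type*} [CommRing F] {n : ℕ}
    {p : Fin n → Fin n → F[X][X][X][X]}
    (h : ∑ a, ∑ b, expandFour F n (p a b) * (C (C X) ^ (a : ℕ) * X ^ (b : ℕ)) = 0)
    (a b : Fin n) : p a b = 0 := by
  have h1 : ∑ b : Fin n, expand F[X][X][X] n (∑ a : Fin n,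
      (p a b).map (mapRingHom (expand F[X] n : F[X][X] →+* F[X][X])) * C (C X ^ (a : ℕ)))
        * X ^ (b : ℕ) = 0 := by
    rw [← h, Finset.sum_comm]
    refine Finset.sum_congr rfl fun b _ => ?_
    rw [map_sum, Finset.sum_mul]
    refine Finset.sum_congr rfl fun a _ => ?_
    simp only [map_mul, expand_C, expandFour, RingHom.comp_apply, coe_mapRingHom, RingHom.coe_coe,
      map_pow]
    ring
  have h2 := eq_zero_of_sum_expand_mul_X_pow_eq_zero h1 b
  ext1 i
  ext1 j
  rw [coeff_zero, coeff_zero]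
  refine eq_zero_of_sum_expand_mul_X_pow_eq_zero (g := fun a => ((p a b).coeff i).coeff j) ?_ a
  have h3 := congrArg (fun f => (coeff f i).coeff j) h2
  simpa only [finsetSum_coeff, coeff_mul_C, coeff_map, coe_mapRingHom, ← C_pow, RingHom.coe_coe,
    coeff_zero] using h3

end Polynomial

section Basis

variable {F : Type} [Field F] [Fintype F]

local notation "𝔮" => Fintype.card F

/-- The generators over the subalgebra of `(q - 1)`-st powers, indexed. -/
def powGen (h : ℕ → R2 F) (j : Fin (𝔮 - 1) × Fin (𝔮 - 1) × GenIdx 𝔮) : R2 F :=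
  d22s F 𝔮 ^ (j.1 : ℕ) * d22 F 𝔮 ^ (j.2.1 : ℕ) * gen h j.2.2

variable {c21 c21s : R2 F} {h : ℕ → R2 F}

theorem mem_span_powGen_of_mem_genSpan {f : R2 F} (hf : f ∈ genSpan c21 c21s h) :
    f ∈ Submodule.span (Algebra.adjoin F {d22 F 𝔮 ^ (𝔮 - 1), c21, d22s F 𝔮 ^ (𝔮 - 1), c21s})
      (Set.range (powGen h)) := by
  have hq : 0 < 𝔮 - 1 := Nat.sub_pos_of_lt Fintype.one_lt_card
  set W := Submodule.span (Algebra.adjoin F {d22 F 𝔮 ^ (𝔮 - 1), c21, d22s F 𝔮 ^ (𝔮 - 1), c21s})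
    (Set.range (powGen h)) with hW
  have hmul : ∀ t ∈ ({d22 F 𝔮 ^ (𝔮 - 1), c21, d22s F 𝔮 ^ (𝔮 - 1), c21s} : Set (R2 F)),
      ∀ w ∈ W, t * w ∈ W := fun t ht w hw => Submodule.smul_mem W (⟨t, Algebra.subset_adjoin ht⟩ :
        Algebra.adjoin F {d22 F 𝔮 ^ (𝔮 - 1), c21, d22s F 𝔮 ^ (𝔮 - 1), c21s}) hw
  have hgen : ∀ t : R2 F, (∀ j, t * powGen h j ∈ W) → ∀ w ∈ W, t * w ∈ W := by
    intro t ht w hw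
    rw [hW] at hw
    induction hw using Submodule.span_induction with
    | mem w hw => obtain ⟨j, rfl⟩ := hw; exact ht j
    | zero => rw [mul_zero]; exact zero_mem _
    | add w w' _ _ h h' => rw [mul_add]; exact add_mem h h'
    | smul b w _ h => rw [mul_smul_comm]; exact Submodule.smul_mem _ b h
  have hpow : ∀ j, powGen h j ∈ W := fun j => Submodule.subset_span ⟨j, rfl⟩
  have hT : ∀ t ∈ Algebra.adjoin F {d22 F 𝔮, c21, d22s F 𝔮, c21s}, ∀ w ∈ W, t * w ∈ W := by
    intro t ht
    induction ht using Algebra.adjoin_induction with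
    | mem t ht =>
      rcases ht with rfl | rfl | rfl | rfl
      · refine hgen _ fun ⟨a, b, m⟩ => ?_
        by_cases hb : (b : ℕ) + 1 < 𝔮 - 1
        · convert hpow (a, ⟨b + 1, hb⟩, m) using 1
          simp only [powGen]
          ring
        · convert hmul (d22 F 𝔮 ^ (𝔮 - 1)) (by simp) _ (hpow (a, ⟨0, hq⟩, m)) using 1
          have hb' : d22 F 𝔮 ^ (𝔮 - 1) = d22 F 𝔮 ^ (b + 1 : ℕ) := by congr 1; omega
          rw [hb']
          simp only [powGen]
          ring
      · exact hmul _ (by simp)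
      · refine hgen _ fun ⟨a, b, m⟩ => ?_
        by_cases ha : (a : ℕ) + 1 < 𝔮 - 1
        · convert hpow (⟨a + 1, ha⟩, b, m) using 1
          simp only [powGen]
          ring
        · convert hmul (d22s F 𝔮 ^ (𝔮 - 1)) (by simp) _ (hpow (⟨0, hq⟩, b, m)) using 1
          have ha' : d22s F 𝔮 ^ (𝔮 - 1) = d22s F 𝔮 ^ (a + 1 : ℕ) := by congr 1; omega
          rw [ha']
          simp only [powGen]
          ring
      · exact hmul _ (by simp)
    | algebraMap r =>
      intro w hw
      rw [← Algebra.smul_def]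
      exact Submodule.smul_of_tower_mem _ r hw
    | add s t _ _ hs ht =>
      intro w hw
      rw [add_mul]
      exact add_mem (hs w hw) (ht w hw)
    | mul s t _ _ hs ht =>
      intro w hw
      rw [mul_assoc]
      exact hs _ (ht w hw)
  rw [genSpan] at hf
  induction hf using Submodule.span_induction with
  | mem f hf =>
    obtain ⟨m, rfl⟩ := hf
    simpa [powGen] using hpow (⟨0, hq⟩, ⟨0, hq⟩, m)
  | zero => exact zero_mem _
  | add f g _ _ hf hg => exact add_mem hf hg
  | smul t f _ hf => exact hT t t.2 f hf

theorem DicksonData.linearIndependent_powGen (D : DicksonData c21 c21s h) :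
    LinearIndependent (Algebra.adjoin F {d22 F 𝔮 ^ (𝔮 - 1), c21, d22s F 𝔮 ^ (𝔮 - 1), c21s})
      (powGen h) := by
  rw [Fintype.linearIndependent_iff]
  intro b hb j
  choose p hp using fun j => Polynomial.mem_adjoin_iff_exists_evalFour.1 (b j).2
  have hsum : ∑ m, evalGen c21 c21s (∑ a, ∑ b, Polynomial.expandFour F (𝔮 - 1) (p (a, b, m)) *
      (Polynomial.C (Polynomial.C Polynomial.X) ^ (a : ℕ) * Polynomial.X ^ (b : ℕ))) *
        gen h m = 0 := by
    rw [← hb]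
    simp only [Fintype.sum_prod_type]
    conv_rhs =>
      enter [2, a]
      rw [Finset.sum_comm]
    rw [Finset.sum_comm]
    refine Finset.sum_congr rfl fun m _ => ?_
    rw [map_sum, Finset.sum_mul]
    refine Finset.sum_congr rfl fun a _ => ?_
    rw [map_sum, Finset.sum_mul]
    refine Finset.sum_congr rfl fun b' _ => ?_
    have hs : evalGen c21 c21s (Polynomial.C (Polynomial.C Polynomial.X)) = d22s F 𝔮 := by
      simp [evalGen, Polynomial.evalTwo]
    have hd : evalGen c21 c21s Polynomial.X = d22 F 𝔮 := by simp [evalGen]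
    rw [map_mul, map_mul, map_pow, map_pow, hs, hd, Subalgebra.smul_def, ← hp,
      ← Polynomial.evalFour_expandFour, smul_eq_mul, powGen, mul_assoc]
    rfl
  have h0 : p j = 0 := Polynomial.eq_zero_of_sum_expandFour_eq_zero
    (p := fun a b => p (a, b, j.2.2)) (D.eq_zero_of_sum_evalGen_mul_eq_zero hsum j.2.2) j.1 j.2.1
  ext1
  rw [← hp j, h0, map_zero]
  rfl

theorem DicksonData.powGen_mem_invariantRing (D : DicksonData c21 c21s h)
    (j : Fin (𝔮 - 1) × Fin (𝔮 - 1) × GenIdx 𝔮) : powGen h j ∈ invariantRing (SL2 F) := by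
  intro A hA
  obtain ⟨a, b, ⟨i, j⟩ | ⟨i, j, k⟩ | ⟨s, k⟩⟩ := j
  · simp only [powGen, gen, map_mul, map_pow, act_d22 hA, act_d22s hA, act_u1 hA, act_u1s hA]
  · simp only [powGen, gen, map_mul, map_pow, act_d22 hA, act_d22s hA, act_u0 hA, act_u1 hA,
      act_u1s hA]
  · have hs : (s : ℕ) + 1 ≤ 𝔮 - 1 := by omega
    simp only [powGen, gen, map_mul, map_pow, act_d22 hA, act_d22s hA, act_u0 hA, D.act_h hA hs]

theorem range_gen :
    Set.range (gen h) =
      {f | ∃ i j, i ≤ 𝔮 - 1 ∧ j ≤ 𝔮 - 1 ∧ f = u1s F 𝔮 ^ i * u1 F 𝔮 ^ j} ∪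
      {f | ∃ i j k, i ≤ 𝔮 - 2 ∧ j ≤ 𝔮 - 2 ∧ 1 ≤ k ∧ k ≤ 𝔮 ∧
        f = u1s F 𝔮 ^ i * u1 F 𝔮 ^ j * u0 F ^ k} ∪
      {f | ∃ s k, 1 ≤ s ∧ s ≤ 𝔮 - 2 ∧ k ≤ 𝔮 - 1 ∧ f = h s * u0 F ^ k} := by
  have hq : 2 ≤ 𝔮 := Fintype.one_lt_card
  ext f
  constructor
  · rintro ⟨⟨i, j⟩ | ⟨i, j, k⟩ | ⟨s, k⟩, rfl⟩
    · exact .inl (.inl ⟨i, j, by omega, by omega, rfl⟩)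
    · exact .inl (.inr ⟨i, j, k + 1, by omega, by omega, by omega, by omega, rfl⟩)
    · exact .inr ⟨s + 1, k, by omega, by omega, by omega, rfl⟩
  · rintro ((⟨i, j, hi, hj, rfl⟩ | ⟨i, j, k, hi, hj, hk, hk', rfl⟩) | ⟨s, k, hs, hs', hk, rfl⟩)
    · exact ⟨.inl (⟨i, by omega⟩, ⟨j, by omega⟩), rfl⟩
    · obtain ⟨k, rfl⟩ := Nat.exists_eq_add_of_le' hk
      exact ⟨.inr (.inl (⟨i, by omega⟩, ⟨j, by omega⟩, ⟨k, by omega⟩)), rfl⟩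
    · obtain ⟨s, rfl⟩ := Nat.exists_eq_add_of_le' hs
      exact ⟨.inr (.inr (⟨s, by omega⟩, ⟨k, by omega⟩)), rfl⟩

theorem range_powGen :
    Set.range (powGen h) = {f | ∃ α β m, α ≤ 𝔮 - 2 ∧ β ≤ 𝔮 - 2 ∧ m ∈ Set.range (gen h) ∧
      f = d22s F 𝔮 ^ α * d22 F 𝔮 ^ β * m} := by
  have hq : 2 ≤ 𝔮 := Fintype.one_lt_card
  ext f
  constructor
  · rintro ⟨⟨a, b, m⟩, rfl⟩
    exact ⟨a, b, _, by omega, by omega, ⟨m, rfl⟩, rfl⟩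
  · rintro ⟨a, b, _, ha, hb, ⟨m, rfl⟩, rfl⟩
    exact ⟨(⟨a, by omega⟩, ⟨b, by omega⟩, m), rfl⟩

end Basis

/-- the set `𝔾 = {(d₂₂*)^α d₂₂^β m : 0 ≤ α,β ≤ q−2, m ∈ 𝕊}` has
`q(q²−1)(q−1)²` elements and is a basis of `R₂^{SL₂}` as a free module over
`ℬ = F_q[d₂₂^{q−1}, c₂₁, (d₂₂*)^{q−1}, c₂₁*]`. -/
theorem stmt_13 (q : ℕ) (hq : IsPrimePow q) (F : Type) [Field F] [Fintype F]
    (hF : Fintype.card F = q)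
    (c21 c21s : R2 F)
    (hc21 : d22 F q * c21 = X 1 * X 0 ^ (q ^ 2) - X 0 * X 1 ^ (q ^ 2))
    (hc21s : d22s F q * c21s = X 2 * X 3 ^ (q ^ 2) - X 3 * X 2 ^ (q ^ 2))
    (h : ℕ → R2 F)
    (hh : ∀ s ≤ q - 1, u0 F ^ q * h s =
      u1 F q ^ (s + 1) * d22s F q ^ (q - s - 1) + u1s F q ^ (q - s) * d22 F q ^ s)
    (𝕊 : Set (R2 F))
    (h𝕊 : 𝕊 =
      {f | ∃ i j, i ≤ q - 1 ∧ j ≤ q - 1 ∧ f = u1s F q ^ i * u1 F q ^ j} ∪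
      {f | ∃ i j k, i ≤ q - 2 ∧ j ≤ q - 2 ∧ 1 ≤ k ∧ k ≤ q ∧
        f = u1s F q ^ i * u1 F q ^ j * u0 F ^ k} ∪
      {f | ∃ s k, 1 ≤ s ∧ s ≤ q - 2 ∧ k ≤ q - 1 ∧ f = h s * u0 F ^ k})
    (𝔾 : Set (R2 F))
    (h𝔾 : 𝔾 = {f | ∃ α β m, α ≤ q - 2 ∧ β ≤ q - 2 ∧ m ∈ 𝕊 ∧
      f = d22s F q ^ α * d22 F q ^ β * m}) :
    𝔾.ncard = q * (q ^ 2 - 1) * (q - 1) ^ 2 ∧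
    𝔾 ⊆ (invariantRing (SL2 F) : Set (R2 F)) ∧
    (∀ f ∈ invariantRing (SL2 F),
      f ∈ Submodule.span
        (Algebra.adjoin F {d22 F q ^ (q - 1), c21, d22s F q ^ (q - 1), c21s}) 𝔾) ∧
    LinearIndependent (Algebra.adjoin F {d22 F q ^ (q - 1), c21, d22s F q ^ (q - 1), c21s})
      (fun b : 𝔾 => (b : R2 F)) := by
  subst hF
  have D : DicksonData c21 c21s h := ⟨hc21, hc21s, hh⟩
  have hq2 : 2 ≤ Fintype.card F := Fintype.one_lt_card
  rw [← range_gen] at h𝕊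
  rw [h𝕊, ← range_powGen] at h𝔾
  subst h𝔾
  have hli := D.linearIndependent_powGen
  refine ⟨?_, ?_, fun f hf => ?_, (linearIndepOn_id_range_iff hli.injective).2 hli⟩
  · rw [Set.ncard_range_of_injective hli.injective, Nat.card_eq_fintype_card, Fintype.card_prod,
      Fintype.card_prod, Fintype.card_fin, card_genIdx hq2]
    ring
  · rintro _ ⟨j, rfl⟩
    exact D.powGen_mem_invariantRing j
  · exact mem_span_powGen_of_mem_genSpan (D.mem_genSpan_of_mem_invariantRing hf)
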